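/- For every n ≥ 2 there exists a global solution u to the thin obstacle problem (with zero obstacle) in ℝ^{n+1}, with polynomial growth of order 4, whose contact set Λ(u) is compact, nonconvex, and star-shaped with respect to the origin. -/

import Mathlib

open MeasureTheory Metric Set Filter

noncomputable section

/-- The point `(x', t)` of `ℝ^{n+1}`, where `x' ∈ ℝ^n`. -/
def thinEmbed (n : ℕ) (x' : EuclideanSpace ℝ (Fin n)) (t : ℝ) :
    EuclideanSpace ℝ (Fin (n + 1)) :=
  (EuclideanSpace.equiv (Fin (n + 1)) ℝ).symm (Fin.snoc (fun i => x' i) t)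

/-- Projection of a point of `ℝ^{n+1}` to its first `n` coordinates. -/
def thinProj (n : ℕ) (x : EuclideanSpace ℝ (Fin (n + 1))) : EuclideanSpace ℝ (Fin n) :=
  (EuclideanSpace.equiv (Fin n) ℝ).symm (fun i => x i.castSucc)

/-- The Laplacian of `f : ℝ^d → ℝ`: the sum of pure second partial derivatives. -/
def lapl (d : ℕ) (f : EuclideanSpace ℝ (Fin d) → ℝ) (x : EuclideanSpace ℝ (Fin d)) : ℝ :=
  ∑ i : Fin d,
    fderiv ℝ (fun y => fderiv ℝ f y (EuclideanSpace.single i 1)) x (EuclideanSpace.single i 1)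

/-- `f` is harmonic on a set: twice continuously differentiable with vanishing Laplacian. -/
def IsHarmonicOnSet (d : ℕ) (f : EuclideanSpace ℝ (Fin d) → ℝ)
    (s : Set (EuclideanSpace ℝ (Fin d))) : Prop :=
  ContDiffOn ℝ 2 f s ∧ ∀ x ∈ s, lapl d f x = 0

/-- Super-mean-value property w.r.t. averages over balls
(encodes `Δf ≤ 0` for continuous `f`). -/
def SuperMeanVal (d : ℕ) (f : EuclideanSpace ℝ (Fin d) → ℝ) : Prop :=
  ∀ (x : EuclideanSpace ℝ (Fin d)) (r : ℝ), 0 < r → (⨍ y in Metric.ball x r, f y) ≤ f x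

/-- The contact set `Λ_φ(u) = {(x',0) : u(x',0) = φ(x')}`. -/
def contactSet (n : ℕ) (φ : EuclideanSpace ℝ (Fin n) → ℝ)
    (u : EuclideanSpace ℝ (Fin (n + 1)) → ℝ) : Set (EuclideanSpace ℝ (Fin (n + 1))) :=
  {x | x (Fin.last n) = 0 ∧ u x = φ (thinProj n x)}

/-- Global solution to the thin obstacle problem in `ℝ^{n+1}` with thin obstacle `φ`:
continuous, even in the last variable, above the obstacle on the thin space,
harmonic outside the contact set, and superharmonic (mean value inequality). -/
def IsGlobalSolution (n : ℕ) (φ : EuclideanSpace ℝ (Fin n) → ℝ)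
    (u : EuclideanSpace ℝ (Fin (n + 1)) → ℝ) : Prop :=
  Continuous u ∧
  (∀ x' t, u (thinEmbed n x' t) = u (thinEmbed n x' (-t))) ∧
  (∀ x', φ x' ≤ u (thinEmbed n x' 0)) ∧
  IsHarmonicOnSet (n + 1) u (contactSet n φ u)ᶜ ∧
  SuperMeanVal (n + 1) u

/-- Evaluation of a real polynomial at a point of `ℝ^d`. -/
def pev {d : ℕ} (q : MvPolynomial (Fin d) ℝ) (x : EuclideanSpace ℝ (Fin d)) : ℝ :=
  MvPolynomial.eval (fun i => x i) q

/-- Polynomial growth (of some order). -/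
def HasPolyGrowth (d : ℕ) (u : EuclideanSpace ℝ (Fin d) → ℝ) : Prop :=
  ∃ (m : ℕ) (C : ℝ), ∀ x, |u x| ≤ C * (1 + ‖x‖ ^ m)

/-- Polynomial growth of order exactly `m` (and `m` is the smallest such order). -/
def PolyGrowthOrder (d : ℕ) (u : EuclideanSpace ℝ (Fin d) → ℝ) (m : ℕ) : Prop :=
  (∃ C : ℝ, ∀ x, |u x| ≤ C * (1 + ‖x‖ ^ m)) ∧
  ∀ m' : ℕ, (∃ C : ℝ, ∀ x, |u x| ≤ C * (1 + ‖x‖ ^ m')) → m ≤ m'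

/-- The class `𝒫ᵒ_{n+1}`: polynomials `q` even in the last variable such that
`x_{n+1} q(x)` is harmonic and `closure {q(·,0) < 0}` is compact. -/
def MemPo (n : ℕ) (q : MvPolynomial (Fin (n + 1)) ℝ) : Prop :=
  (∀ x' t, pev q (thinEmbed n x' t) = pev q (thinEmbed n x' (-t))) ∧
  IsHarmonicOnSet (n + 1) (fun x => x (Fin.last n) * pev q x) Set.univ ∧
  IsCompact (closure {x' : EuclideanSpace ℝ (Fin n) | pev q (thinEmbed n x' 0) < 0})

/-- The class `𝒫ᵉ_{n+1}`: harmonic polynomials `p` even in the last variable such that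
`closure {p(·,0) < 0}` is compact. -/
def MemPe (n : ℕ) (p : MvPolynomial (Fin (n + 1)) ℝ) : Prop :=
  (∀ x' t, pev p (thinEmbed n x' t) = pev p (thinEmbed n x' (-t))) ∧
  IsHarmonicOnSet (n + 1) (pev p) Set.univ ∧
  IsCompact (closure {x' : EuclideanSpace ℝ (Fin n) | pev p (thinEmbed n x' 0) < 0})

/-- `f(x) → 0` as `|x| → ∞`. -/
def VanishAtInfty (d : ℕ) (f : EuclideanSpace ℝ (Fin d) → ℝ) : Prop :=
  ∀ ε > 0, ∃ R : ℝ, ∀ x, R ≤ ‖x‖ → |f x| < ε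

/-- The embedding of a subset of `ℝ^n` into the thin space of `ℝ^{n+1}`. -/
def thinSet (n : ℕ) (S : Set (EuclideanSpace ℝ (Fin n))) :
    Set (EuclideanSpace ℝ (Fin (n + 1))) :=
  (fun x' => thinEmbed n x' 0) '' S

/-- The free boundary `Γ(u)`: the boundary in `ℝ^n` of the positivity set, embedded. -/
def freeBoundary (n : ℕ) (u : EuclideanSpace ℝ (Fin (n + 1)) → ℝ) :
    Set (EuclideanSpace ℝ (Fin (n + 1))) :=
  thinSet n (frontier {x' : EuclideanSpace ℝ (Fin n) | 0 < u (thinEmbed n x' 0)})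

/-- Negating the `i`-th coordinate of a point of `ℝ^d`. -/
def negCoordAt (d : ℕ) (i : Fin d) (x : EuclideanSpace ℝ (Fin d)) :
    EuclideanSpace ℝ (Fin d) :=
  (EuclideanSpace.equiv (Fin d) ℝ).symm (Function.update (fun j => x j) i (-(x i)))

/-- The constant `ρ̄(k, n)`, where `κ = k/(n-1)`. -/
def rhoBar (k n : ℕ) : ℝ :=
  ((k : ℝ) / ((n : ℝ) - 1)) ^ (-(1 : ℝ) / (((n : ℝ) - 1) * ((k : ℝ) / ((n : ℝ) - 1) + 1))) *
    (((k : ℝ) / ((n : ℝ) - 1)) ^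
        (-((k : ℝ) / ((n : ℝ) - 1)) / ((k : ℝ) / ((n : ℝ) - 1) + 1)) +
      ((k : ℝ) / ((n : ℝ) - 1)) ^ ((1 : ℝ) / ((k : ℝ) / ((n : ℝ) - 1) + 1))) ^
      (-(1 : ℝ) / (((n : ℝ) - 1) * ((k : ℝ) / ((n : ℝ) - 1))))

/-- The barrier function `g_{A,t}(r) = A r^{1-n} + t - 1 + r^k`. -/
def gfun (n k : ℕ) (A t r : ℝ) : ℝ :=
  A * r ^ ((1 : ℝ) - (n : ℝ)) + t - 1 + r ^ k

section MeanValue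

variable {d : ℕ}

/-- The Lipschitz weight `(1 - ‖y‖²)₊ / 2`, whose gradient is `-y` on the unit ball. -/
def ballWeight (d : ℕ) (y : EuclideanSpace ℝ (Fin d)) : ℝ := (1 - (min ‖y‖ 1) ^ 2) / 2

lemma ballWeight_lipschitz : LipschitzWith 1 (ballWeight d) := by
  refine LipschitzWith.of_dist_le_mul fun x y => ?_
  simp only [ballWeight, Real.dist_eq, NNReal.coe_one, one_mul]
  have h1 : |min ‖x‖ 1 - min ‖y‖ 1| ≤ dist x y := by
    have := ((LipschitzWith.id (α := ℝ)).min_const 1).dist_le_mul ‖x‖ ‖y‖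
    simp only [Real.dist_eq, NNReal.coe_one, one_mul, id] at this
    exact this.trans ((abs_norm_sub_norm_le x y).trans (dist_eq_norm x y).ge)
  have hx0 : 0 ≤ min ‖x‖ 1 := by positivity
  have hy0 : 0 ≤ min ‖y‖ 1 := by positivity
  have hx1 : min ‖x‖ 1 ≤ 1 := min_le_right _ _
  have hy1 : min ‖y‖ 1 ≤ 1 := min_le_right _ _
  set a := min ‖x‖ 1
  set b := min ‖y‖ 1
  have : (1 - a ^ 2) / 2 - (1 - b ^ 2) / 2 = -((a - b) * ((a + b) / 2)) := by ring
  rw [this, abs_neg, abs_mul, abs_of_nonneg (by positivity : 0 ≤ (a + b) / 2)]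
  nlinarith [abs_nonneg (a - b)]

lemma ballWeight_nonneg (y : EuclideanSpace ℝ (Fin d)) : 0 ≤ ballWeight d y := by
  have h0 : 0 ≤ min ‖y‖ 1 := by positivity
  have h1 : min ‖y‖ 1 ≤ 1 := min_le_right _ _
  unfold ballWeight
  nlinarith

lemma ballWeight_eq_zero {y : EuclideanSpace ℝ (Fin d)} (hy : 1 ≤ ‖y‖) : ballWeight d y = 0 := by
  simp [ballWeight, hy]

lemma ballWeight_hasCompactSupport : HasCompactSupport (ballWeight d) := by
  refine HasCompactSupport.intro (isCompact_closedBall 0 1) fun y hy => ballWeight_eq_zero ?_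
  simp only [mem_closedBall, dist_zero_right, not_le] at hy
  exact hy.le

lemma lineDeriv_ballWeight_of_lt {y : EuclideanSpace ℝ (Fin d)} (hy : ‖y‖ < 1) (i : Fin d) :
    lineDeriv ℝ (ballWeight d) y (-EuclideanSpace.single i 1) = y i := by
  have h : HasFDerivAt (fun y : EuclideanSpace ℝ (Fin d) => (1 - ‖y‖ ^ 2) / 2)
      (-(innerSL ℝ y)) y := by
    have := (((hasStrictFDerivAt_norm_sq y).hasFDerivAt).const_sub 1).const_mul (1 / 2 : ℝ)
    refine (this.congr_fderiv ?_).congr_of_eventuallyEq (Eventually.of_forall fun z => by ring)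
    ext z
    simp
  have h2 : ballWeight d =ᶠ[nhds y] fun y => (1 - ‖y‖ ^ 2) / 2 := by
    filter_upwards [(isOpen_lt continuous_norm continuous_const).mem_nhds hy] with z hz
    simp [ballWeight, min_eq_left (le_of_lt hz)]
  rw [((h.congr_of_eventuallyEq h2).hasLineDerivAt _).lineDeriv]
  simp [EuclideanSpace.inner_single_right]

lemma lineDeriv_ballWeight_of_gt {y : EuclideanSpace ℝ (Fin d)} (hy : 1 < ‖y‖)
    (v : EuclideanSpace ℝ (Fin d)) :
    lineDeriv ℝ (ballWeight d) y v = 0 := by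
  have h2 : ballWeight d =ᶠ[nhds y] fun _ => 0 := by
    filter_upwards [(isOpen_lt continuous_const continuous_norm).mem_nhds hy] with z hz
    exact ballWeight_eq_zero (le_of_lt hz)
  rw [(((hasFDerivAt_const (0 : ℝ) y).congr_of_eventuallyEq h2).hasLineDerivAt _).lineDeriv]
  simp

lemma integral_ball_coord_mul (hd : 0 < d) {g : EuclideanSpace ℝ (Fin d) → ℝ} {C : NNReal}
    (hg : LipschitzWith C g) (i : Fin d) :
    ∫ y in ball (0 : EuclideanSpace ℝ (Fin d)) 1, y i * g y =
      ∫ y, lineDeriv ℝ g y (EuclideanSpace.single i 1) * ballWeight d y := by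
  have : Nonempty (Fin d) := ⟨⟨0, hd⟩⟩
  rw [hg.integral_lineDeriv_mul_eq ballWeight_lipschitz ballWeight_hasCompactSupport,
    ← integral_indicator measurableSet_ball]
  refine integral_congr_ae ?_
  have hs : ∀ᵐ y : EuclideanSpace ℝ (Fin d), y ∉ sphere (0 : EuclideanSpace ℝ (Fin d)) 1 := by
    exact measure_eq_zero_iff_ae_notMem.1
      (Measure.addHaar_sphere (volume : Measure (EuclideanSpace ℝ (Fin d))) 0 1)
  filter_upwards [hs] with y hy
  rcases lt_trichotomy ‖y‖ 1 with h | h | h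
  · rw [indicator_of_mem (by simpa using h), lineDeriv_ballWeight_of_lt h]
  · simp [h] at hy
  · rw [indicator_of_notMem (by simpa using h.le), lineDeriv_ballWeight_of_gt h]
    simp

lemma ContDiff.contDiff_fderiv_apply_one {f : EuclideanSpace ℝ (Fin d) → ℝ} (hf : ContDiff ℝ 2 f)
    (v : EuclideanSpace ℝ (Fin d)) : ContDiff ℝ 1 (fun y => fderiv ℝ f y v) :=
  (hf.fderiv_right (m := 1) (by norm_num)).clm_apply contDiff_const

lemma integral_ball_fderiv_radial_nonpos (hd : 0 < d) {f : EuclideanSpace ℝ (Fin d) → ℝ}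
    (hf : ContDiff ℝ 2 f) (hc : HasCompactSupport f) (x : EuclideanSpace ℝ (Fin d)) {r : ℝ}
    (hr : 0 < r) (hl : ∀ y ∈ ball x r, lapl d f y ≤ 0) :
    ∫ y in ball (0 : EuclideanSpace ℝ (Fin d)) 1, fderiv ℝ f (x + r • y) y ≤ 0 := by
  have hg : ∀ i : Fin d, ContDiff ℝ 1
      (fun y => fderiv ℝ f (x + r • y) (EuclideanSpace.single i 1)) := fun i =>
    (hf.contDiff_fderiv_apply_one _).comp (by fun_prop)
  have hLip : ∀ i : Fin d, ∃ C : NNReal, LipschitzWith C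
      (fun y => fderiv ℝ f (x + r • y) (EuclideanSpace.single i 1)) := by
    intro i
    refine ⟨_, (hg i).lipschitzWith_of_hasCompactSupport ?_ (by norm_num) |>.choose_spec⟩
    have h1 : HasCompactSupport (fun y => fderiv ℝ f y (EuclideanSpace.single i 1)) :=
      hc.fderiv_apply (𝕜 := ℝ) _
    let e := (Homeomorph.smulOfNeZero r hr.ne').trans (Homeomorph.addLeft x)
    exact h1.comp_homeomorph e
  have hexp : ∀ y : EuclideanSpace ℝ (Fin d), fderiv ℝ f (x + r • y) y =
      ∑ i, y i * fderiv ℝ f (x + r • y) (EuclideanSpace.single i 1) := by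
    intro y
    generalize fderiv ℝ f (x + r • y) = T
    conv_lhs => rw [← (EuclideanSpace.basisFun (Fin d) ℝ).sum_repr y]
    simp [map_sum]
  have hintg : ∀ i : Fin d, IntegrableOn
      (fun y : EuclideanSpace ℝ (Fin d) =>
        y i * fderiv ℝ f (x + r • y) (EuclideanSpace.single i 1)) (ball 0 1) := by
    intro i
    have hcont : Continuous (fun y : EuclideanSpace ℝ (Fin d) =>
        y i * fderiv ℝ f (x + r • y) (EuclideanSpace.single i 1)) :=
      (by fun_prop : Continuous fun y : EuclideanSpace ℝ (Fin d) => y i).mul (hg i).continuous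
    exact (hcont.continuousOn.integrableOn_compact (isCompact_closedBall 0 1)).mono_set
      ball_subset_closedBall
  have hline : ∀ (i : Fin d) (y : EuclideanSpace ℝ (Fin d)),
      lineDeriv ℝ (fun y => fderiv ℝ f (x + r • y) (EuclideanSpace.single i 1)) y
        (EuclideanSpace.single i 1) = r * fderiv ℝ (fun z => fderiv ℝ f z
          (EuclideanSpace.single i 1)) (x + r • y) (EuclideanSpace.single i 1) := by
    intro i y
    have h1 := ((hf.contDiff_fderiv_apply_one (EuclideanSpace.single i 1)).differentiable
      (by norm_num) (x + r • y)).hasFDerivAt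
    have h2 : HasFDerivAt (fun y : EuclideanSpace ℝ (Fin d) => x + r • y)
        (r • ContinuousLinearMap.id ℝ _) y := ((hasFDerivAt_id y).const_smul r).const_add x
    refine ((h1.comp y h2).hasLineDerivAt (EuclideanSpace.single i 1)).lineDeriv.trans ?_
    simp
  simp_rw [hexp]
  rw [integral_finsetSum _ (fun i _ => hintg i)]
  choose C hC using hLip
  simp_rw [fun i => integral_ball_coord_mul hd (hC i) i, hline]
  have hintg2 : ∀ i : Fin d, Integrable
      (fun y : EuclideanSpace ℝ (Fin d) => r * fderiv ℝ (fun z => fderiv ℝ f z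
          (EuclideanSpace.single i 1)) (x + r • y) (EuclideanSpace.single i 1)
          * ballWeight d y) := by
    intro i
    refine Continuous.integrable_of_hasCompactSupport ?_ ballWeight_hasCompactSupport.mul_left
    refine Continuous.mul (continuous_const.mul ?_) ballWeight_lipschitz.continuous
    have := ((hf.contDiff_fderiv_apply_one (EuclideanSpace.single i 1)).continuous_fderiv
      (by norm_num)).clm_apply (continuous_const (y := EuclideanSpace.single i (1 : ℝ)))
    exact this.comp (by fun_prop)
  rw [← integral_finsetSum _ (fun i _ => hintg2 i)]
  refine integral_nonpos fun y => ?_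
  simp only [Pi.zero_apply]
  rw [← Finset.sum_mul, ← Finset.mul_sum]
  change r * lapl d f (x + r • y) * ballWeight d y ≤ 0
  by_cases hy : ‖y‖ < 1
  · refine mul_nonpos_of_nonpos_of_nonneg (mul_nonpos_of_nonneg_of_nonpos hr.le (hl _ ?_))
      (ballWeight_nonneg y)
    simp only [mem_ball, dist_self_add_left, norm_smul, Real.norm_eq_abs, abs_of_pos hr]
    nlinarith
  · simp [ballWeight_eq_zero (not_lt.1 hy)]

lemma setIntegral_ball_eq_unitBall (f : EuclideanSpace ℝ (Fin d) → ℝ)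
    (x : EuclideanSpace ℝ (Fin d)) {r : ℝ} (hr : 0 < r) :
    ∫ y in ball x r, f y = r ^ d * ∫ y in ball (0 : EuclideanSpace ℝ (Fin d)) 1, f (x + r • y) := by
  have h := Measure.setIntegral_comp_smul_of_pos volume
    (fun y : EuclideanSpace ℝ (Fin d) => f (x + y)) (ball 0 1) hr
  rw [h, _root_.smul_unitBall_of_pos hr]
  have h2 : ∫ y in ball (0 : EuclideanSpace ℝ (Fin d)) r, f (x + y) = ∫ y in ball x r, f y := by
    have := (measurePreserving_add_left (volume : Measure (EuclideanSpace ℝ (Fin d))) x)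
      |>.setIntegral_preimage_emb (measurableEmbedding_addLeft x) f (ball x r)
    rw [← this]
    congr 2
    ext y
    simp
  rw [h2, finrank_euclideanSpace_fin, smul_eq_mul, ← mul_assoc, mul_inv_cancel₀ (by positivity),
    one_mul]

lemma setIntegral_ball_le_of_compact (hd : 0 < d) {f : EuclideanSpace ℝ (Fin d) → ℝ}
    (hf : ContDiff ℝ 2 f) (hc : HasCompactSupport f) (x : EuclideanSpace ℝ (Fin d)) {R : ℝ}
    (hR : 0 < R) (hl : ∀ y ∈ ball x R, lapl d f y ≤ 0) :
    ∫ y in ball x R, f y ≤ volume.real (ball x R) * f x := by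
  have : Nonempty (Fin d) := ⟨⟨0, hd⟩⟩
  set B := ball (0 : EuclideanSpace ℝ (Fin d)) 1
  obtain ⟨C, hC⟩ := (hc.fderiv (𝕜 := ℝ)).exists_bound_of_continuous
    (hf.continuous_fderiv (by norm_num))
  have hderiv : ∀ r : ℝ, HasDerivAt (fun r : ℝ => ∫ y in B, f (x + r • y))
      (∫ y in B, fderiv ℝ f (x + r • y) y) r := by
    intro r
    refine (hasDerivAt_integral_of_dominated_loc_of_deriv_le (μ := volume.restrict B)
      (F := fun (r : ℝ) y => f (x + r • y)) (F' := fun r y => fderiv ℝ f (x + r • y) y)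
      (s := univ) (bound := fun _ => C) univ_mem
      ?_ ?_ ?_ ?_ ?_ ?_).2
    · exact Eventually.of_forall fun s =>
        (hf.continuous.comp (by fun_prop :
          Continuous fun y : EuclideanSpace ℝ (Fin d) => x + s • y)).aestronglyMeasurable
    · exact ((hf.continuous.comp (by fun_prop : Continuous fun y => x + r • y)).continuousOn
        |>.integrableOn_compact (isCompact_closedBall 0 1)).mono_set ball_subset_closedBall
    · exact (((hf.continuous_fderiv (by norm_num)).comp
        (by fun_prop : Continuous fun y : EuclideanSpace ℝ (Fin d) => x + r • y)).clm_apply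
          continuous_id).aestronglyMeasurable
    · refine (ae_restrict_iff' measurableSet_ball).2 (Eventually.of_forall fun y hy s _ => ?_)
      have hy1 : ‖y‖ ≤ 1 := by simpa using (mem_ball_zero_iff.1 hy).le
      calc ‖fderiv ℝ f (x + s • y) y‖ ≤ ‖fderiv ℝ f (x + s • y)‖ * ‖y‖ :=
            ContinuousLinearMap.le_opNorm _ _
        _ ≤ C * 1 := mul_le_mul (hC _) hy1 (norm_nonneg _) ((norm_nonneg _).trans (hC x))
        _ = C := mul_one C
    · exact integrableOn_const (measure_ball_lt_top.ne)
    · refine Eventually.of_forall fun y s _ => ?_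
      have h1 := (hf.differentiable (by norm_num) (x + s • y)).hasFDerivAt
      have h2 : HasDerivAt (fun s : ℝ => x + s • y) y s := by
        simpa using ((hasDerivAt_id s).smul_const y).const_add x
      exact h1.comp_hasDerivAt s h2
  have hanti : AntitoneOn (fun r : ℝ => ∫ y in B, f (x + r • y)) (Icc 0 R) := by
    refine antitoneOn_of_deriv_nonpos (convex_Icc 0 R)
      (fun r _ => (hderiv r).continuousAt.continuousWithinAt)
      (fun r _ => (hderiv r).differentiableAt.differentiableWithinAt) fun r hr => ?_
    rw [interior_Icc] at hr
    rw [(hderiv r).deriv]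
    exact integral_ball_fderiv_radial_nonpos hd hf hc x hr.1
      fun y hy => hl y (ball_subset_ball hr.2.le hy)
  have h1 := hanti (left_mem_Icc.2 hR.le) (right_mem_Icc.2 hR.le) hR.le
  simp only [zero_smul, add_zero, setIntegral_const, smul_eq_mul] at h1
  rw [setIntegral_ball_eq_unitBall f x hR]
  have hvol : volume.real (ball x R) = R ^ d * volume.real B := by
    have := setIntegral_ball_eq_unitBall (fun _ => 1) x hR
    simpa using this
  rw [hvol, mul_assoc]
  exact mul_le_mul_of_nonneg_left h1 (by positivity)

lemma lapl_congr {f g : EuclideanSpace ℝ (Fin d) → ℝ} {x : EuclideanSpace ℝ (Fin d)}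
    (h : f =ᶠ[nhds x] g) : lapl d f x = lapl d g x := by
  unfold lapl
  refine Finset.sum_congr rfl fun i _ => ?_
  have : (fun y => fderiv ℝ f y (EuclideanSpace.single i 1)) =ᶠ[nhds x]
      fun y => fderiv ℝ g y (EuclideanSpace.single i 1) :=
    (h.fderiv (𝕜 := ℝ)).mono fun y hy => by simp only [hy]
  rw [this.fderiv_eq]

/-- Mean value inequality on balls for `C²` functions with nonpositive Laplacian. -/
lemma setIntegral_ball_le (hd : 0 < d) {f : EuclideanSpace ℝ (Fin d) → ℝ}
    {s : Set (EuclideanSpace ℝ (Fin d))} (hs : IsOpen s)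
    (hf : ContDiffOn ℝ 2 f s) (x : EuclideanSpace ℝ (Fin d)) {R : ℝ} (hR : 0 < R)
    (hsub : closedBall x R ⊆ s) (hl : ∀ y ∈ ball x R, lapl d f y ≤ 0) :
    ∫ y in ball x R, f y ≤ volume.real (ball x R) * f x := by
  obtain ⟨δ, hδ, hδs⟩ := (isCompact_closedBall x R).exists_cthickening_subset_open hs hsub
  rw [cthickening_closedBall hδ.le hR.le] at hδs
  let χ : ContDiffBump x := ⟨R + δ / 3, R + δ / 2, by positivity, by linarith⟩
  have hχ1 : ∀ y ∈ ball x (R + δ / 3), χ y = 1 := fun y hy =>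
    χ.one_of_mem_closedBall (ball_subset_closedBall hy)
  let g : EuclideanSpace ℝ (Fin d) → ℝ := fun y => χ y * f y
  have hgc : HasCompactSupport g := χ.hasCompactSupport.mul_right
  have hg : ContDiff ℝ 2 g := by
    rw [contDiff_iff_contDiffAt]
    intro y
    by_cases hy : y ∈ s
    · exact χ.contDiff.contDiffAt.mul (hf.contDiffAt (hs.mem_nhds hy))
    · have h0 : g =ᶠ[nhds y] fun _ => 0 := by
        have hy' : R + δ / 2 < dist y x := by
          by_contra hcon
          exact hy (hδs (mem_closedBall.2 (by linarith)))
        filter_upwards [(isOpen_lt continuous_const (continuous_id.dist continuous_const)).mem_nhds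
          hy'] with z hz
        have : χ z = 0 := χ.zero_of_le_dist (le_of_lt hz)
        simp [g, this]
      exact contDiffAt_const.congr_of_eventuallyEq h0
  have heq : ∀ y ∈ ball x (R + δ / 3), g y = f y := fun y hy => by simp [g, hχ1 y hy]
  have hlap : ∀ y ∈ ball x R, lapl d g y ≤ 0 := by
    intro y hy
    have : g =ᶠ[nhds y] f := by
      filter_upwards [isOpen_ball.mem_nhds (ball_subset_ball (by linarith : R ≤ R + δ / 3) hy)]
        with z hz using heq z hz
    rw [lapl_congr this]
    exact hl y hy
  have := setIntegral_ball_le_of_compact hd hg hgc x hR hlap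
  rw [heq x (mem_ball_self (by positivity))] at this
  rwa [setIntegral_congr_fun measurableSet_ball
    (fun y hy => heq y (ball_subset_ball (by linarith) hy))] at this

lemma lapl_neg (f : EuclideanSpace ℝ (Fin d) → ℝ) (x : EuclideanSpace ℝ (Fin d)) :
    lapl d (fun y => -f y) x = -lapl d f x := by
  simp only [lapl, fderiv_fun_neg, neg_apply, Finset.sum_neg_distrib]

/-- Mean value property on balls for harmonic functions. -/
lemma setIntegral_ball_eq (hd : 0 < d) {f : EuclideanSpace ℝ (Fin d) → ℝ}
    {s : Set (EuclideanSpace ℝ (Fin d))} (hs : IsOpen s)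
    (hf : ContDiffOn ℝ 2 f s) (x : EuclideanSpace ℝ (Fin d)) {R : ℝ} (hR : 0 < R)
    (hsub : closedBall x R ⊆ s) (hl : ∀ y ∈ ball x R, lapl d f y = 0) :
    ∫ y in ball x R, f y = volume.real (ball x R) * f x := by
  refine le_antisymm (setIntegral_ball_le hd hs hf x hR hsub fun y hy => (hl y hy).le) ?_
  have := setIntegral_ball_le hd hs hf.neg x hR hsub
    fun y hy => by rw [lapl_neg, hl y hy, neg_zero]
  rw [integral_neg] at this
  linarith

end MeanValue

section Kernel

variable {d : ℕ}

lemma fderiv_shifted_pow (p ε : ℝ) (y z : EuclideanSpace ℝ (Fin d)) (h : 0 < ‖z - y‖ ^ 2 + ε)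
    (i : Fin d) :
    fderiv ℝ (fun w => (‖w - y‖ ^ 2 + ε) ^ p) z (EuclideanSpace.single i 1) =
      (‖z - y‖ ^ 2 + ε) ^ (p - 1) * (2 * p * (z i - y i)) := by
  have h1 : HasFDerivAt (fun w : EuclideanSpace ℝ (Fin d) => ‖w - y‖ ^ 2 + ε)
      (2 • innerSL ℝ (z - y)) z := by
    have h2 : HasFDerivAt (fun w : EuclideanSpace ℝ (Fin d) => w - y)
      (ContinuousLinearMap.id ℝ _) z := (hasFDerivAt_id z).sub_const y
    have := ((hasStrictFDerivAt_norm_sq (z - y)).hasFDerivAt.comp z h2).add_const ε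
    simpa using this
  rw [(h1.rpow_const (p := p) (Or.inl h.ne')).fderiv]
  simp [EuclideanSpace.inner_single_right]
  ring

lemma eventually_shifted_pos (ε : ℝ) (y z : EuclideanSpace ℝ (Fin d))
    (h : 0 < ‖z - y‖ ^ 2 + ε) : ∀ᶠ w in nhds z, 0 < ‖w - y‖ ^ 2 + ε :=
  (isOpen_lt continuous_const (by fun_prop)).mem_nhds h

lemma contDiffAt_shifted_pow (p ε : ℝ) (y z : EuclideanSpace ℝ (Fin d))
    (h : 0 < ‖z - y‖ ^ 2 + ε) (k : WithTop ℕ∞) :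
    ContDiffAt ℝ k (fun w => (‖w - y‖ ^ 2 + ε) ^ p) z := by
  refine ContDiffAt.rpow_const_of_ne ?_ h.ne'
  exact (((contDiff_id.sub contDiff_const).norm_sq ℝ).add contDiff_const).contDiffAt

lemma lapl_shifted_pow (p ε : ℝ) (hp : p = -(((d : ℝ) - 2) / 2))
    (y z : EuclideanSpace ℝ (Fin d)) (h : 0 < ‖z - y‖ ^ 2 + ε) :
    lapl d (fun w => (‖w - y‖ ^ 2 + ε) ^ p) z = 2 * p * d * ε * (‖z - y‖ ^ 2 + ε) ^ (p - 2) := by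
  have key : ∀ i : Fin d, fderiv ℝ (fun w => fderiv ℝ (fun w => (‖w - y‖ ^ 2 + ε) ^ p) w
      (EuclideanSpace.single i 1)) z (EuclideanSpace.single i 1) =
      (‖z - y‖ ^ 2 + ε) ^ (p - 2) * (4 * p * (p - 1) * (z i - y i) ^ 2
        + 2 * p * (‖z - y‖ ^ 2 + ε)) := by
    intro i
    have he : (fun w => fderiv ℝ (fun w => (‖w - y‖ ^ 2 + ε) ^ p) w (EuclideanSpace.single i 1))
        =ᶠ[nhds z] fun w => (‖w - y‖ ^ 2 + ε) ^ (p - 1) * (2 * p * (w i - y i)) := by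
      filter_upwards [eventually_shifted_pos ε y z h] with w hw
      exact fderiv_shifted_pow p ε y w hw i
    have h1 := ((contDiffAt_shifted_pow (p - 1) ε y z h 1).differentiableAt
      (by norm_num)).hasFDerivAt
    have h2 : HasFDerivAt (fun w : EuclideanSpace ℝ (Fin d) => 2 * p * (w i - y i))
        ((2 * p) • EuclideanSpace.proj i) z :=
      (((EuclideanSpace.proj (𝕜 := ℝ) i).hasFDerivAt).sub_const (y i)).const_mul (2 * p)
    rw [he.fderiv_eq, (h1.fun_mul h2).fderiv]
    have h3 := fderiv_shifted_pow (p - 1) ε y z h i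
    have h4 : (‖z - y‖ ^ 2 + ε) ^ (p - 1) =
        (‖z - y‖ ^ 2 + ε) ^ (p - 2) * (‖z - y‖ ^ 2 + ε) := by
      rw [← Real.rpow_add_one h.ne']
      congr 1
      ring
    simp only [add_apply, smul_apply, h3, smul_eq_mul]
    simp only [PiLp.proj_apply, PiLp.single_apply, if_true]
    rw [h4, show p - 1 - 1 = p - 2 by ring]
    ring
  have hn : ‖z - y‖ ^ 2 = ∑ i, (z i - y i) ^ 2 := by
    rw [EuclideanSpace.norm_sq_eq]
    simp
  rw [lapl, Finset.sum_congr rfl fun i _ => key i, ← Finset.mul_sum, Finset.sum_add_distrib,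
    ← Finset.mul_sum, ← hn]
  simp only [Finset.sum_const, Finset.card_univ, Fintype.card_fin, nsmul_eq_mul]
  have : (d : ℝ) = 2 - 2 * p := by rw [hp]; ring
  rw [this]
  ring

/-- The Newtonian kernel `|x - y|^{-m}` with values in `[0, ∞]`. -/
def kern {X : Type*} [PseudoEMetricSpace X] (m : ℕ) (x y : X) : ENNReal := (edist x y)⁻¹ ^ m

lemma kern_comm {X : Type*} [PseudoEMetricSpace X] (m : ℕ) (x y : X) :
    kern m x y = kern m y x := by
  rw [kern, kern, edist_comm]

lemma continuous_kern {X : Type*} [PseudoEMetricSpace X] (m : ℕ) :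
    Continuous fun z : X × X => kern m z.1 z.2 := by
  unfold kern
  exact (ENNReal.continuous_pow m).comp (continuous_edist.inv)

lemma kern_eq_ofReal {X : Type*} [MetricSpace X] (m : ℕ) {x y : X} (h : x ≠ y) :
    kern m x y = ENNReal.ofReal ((dist x y)⁻¹ ^ m) := by
  have := dist_pos.2 h
  rw [kern, edist_dist, ENNReal.ofReal_pow (by positivity), ENNReal.ofReal_inv_of_pos this]

lemma kern_eq_ofReal_rpow (m : ℕ) {x y : EuclideanSpace ℝ (Fin d)} (h : x ≠ y) :
    kern m x y = ENNReal.ofReal ((‖x - y‖ ^ 2 + 0) ^ (-((m : ℝ) / 2))) := by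
  rw [kern_eq_ofReal m h, dist_eq_norm]
  have : 0 < ‖x - y‖ := norm_pos_iff.2 (sub_ne_zero.2 h)
  congr 1
  rw [add_zero, ← Real.rpow_natCast (‖x - y‖) 2, ← Real.rpow_mul this.le, inv_pow,
    ← Real.rpow_natCast, ← Real.rpow_neg this.le]
  congr 1
  push_cast
  ring

lemma kern_self {X : Type*} [PseudoEMetricSpace X] {m : ℕ} (hm : m ≠ 0) (x : X) :
    kern m x x = ⊤ := by
  simp [kern, hm]

lemma lintegral_ball_shifted_pow_le (m : ℕ) {ε : ℝ} (hε : 0 < ε)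
    (x y : EuclideanSpace ℝ (Fin (m + 2))) {r : ℝ} (hr : 0 < r) :
    ∫⁻ z in ball x r, ENNReal.ofReal ((‖z - y‖ ^ 2 + ε) ^ (-((m : ℝ) / 2))) ≤
      volume (ball x r) * ENNReal.ofReal ((‖x - y‖ ^ 2 + ε) ^ (-((m : ℝ) / 2))) := by
  have hpos : ∀ z : EuclideanSpace ℝ (Fin (m + 2)), 0 < ‖z - y‖ ^ 2 + ε := fun z => by positivity
  have hsm : ContDiff ℝ 2
      (fun w : EuclideanSpace ℝ (Fin (m + 2)) => (‖w - y‖ ^ 2 + ε) ^ (-((m : ℝ) / 2))) :=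
    contDiff_iff_contDiffAt.2 fun z => contDiffAt_shifted_pow _ ε y z (hpos z) 2
  have h1 := setIntegral_ball_le (by omega) isOpen_univ hsm.contDiffOn x hr (subset_univ _)
    fun z _ => by
      rw [lapl_shifted_pow _ ε (by push_cast; ring) y z (hpos z)]
      have h5 : 0 ≤ (‖z - y‖ ^ 2 + ε) ^ (-((m : ℝ) / 2) - 2) := Real.rpow_nonneg (hpos z).le _
      have h6 : 0 ≤ 2 * ((m : ℝ) / 2) * ((m + 2 : ℕ) : ℝ) * ε := by positivity
      nlinarith
  have hintg : IntegrableOn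
      (fun w : EuclideanSpace ℝ (Fin (m + 2)) => (‖w - y‖ ^ 2 + ε) ^ (-((m : ℝ) / 2)))
      (ball x r) :=
    (hsm.continuous.continuousOn.integrableOn_compact (isCompact_closedBall x r)).mono_set
      ball_subset_closedBall
  rw [← ofReal_integral_eq_lintegral_ofReal hintg
    (Eventually.of_forall fun z => Real.rpow_nonneg (hpos z).le _)]
  refine (ENNReal.ofReal_le_ofReal h1).trans ?_
  rw [ENNReal.ofReal_mul measureReal_nonneg, ofReal_measureReal (measure_ball_lt_top.ne)]

/-- The Newtonian kernel has the super mean value property. -/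
lemma lintegral_ball_kern_le {m : ℕ} (hm : m ≠ 0) (x y : EuclideanSpace ℝ (Fin (m + 2)))
    {r : ℝ} (hr : 0 < r) :
    ∫⁻ z in ball x r, kern m z y ≤ volume (ball x r) * kern m x y := by
  rcases eq_or_ne x y with rfl | hxy
  · rw [kern_self hm, ENNReal.mul_top (measure_ball_pos _ _ hr).ne']
    exact le_top
  set f : ℕ → EuclideanSpace ℝ (Fin (m + 2)) → ENNReal := fun k z =>
    ENNReal.ofReal ((‖z - y‖ ^ 2 + 1 / ((k : ℝ) + 1)) ^ (-((m : ℝ) / 2)))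
  have hlim : ∀ z, z ≠ y → Tendsto (fun k => f k z) atTop (nhds (kern m z y)) := by
    intro z hz
    rw [kern_eq_ofReal_rpow m hz]
    refine ENNReal.tendsto_ofReal ?_
    have h0 : 0 < ‖z - y‖ ^ 2 + 0 := by
      have : 0 < ‖z - y‖ := norm_pos_iff.2 (sub_ne_zero.2 hz)
      positivity
    exact (tendsto_const_nhds.add tendsto_one_div_add_atTop_nhds_zero_nat).rpow_const
      (Or.inl h0.ne')
  have hmeas : ∀ k, Measurable (f k) := by
    intro k
    have : Continuous fun z : EuclideanSpace ℝ (Fin (m + 2)) =>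
        (‖z - y‖ ^ 2 + 1 / ((k : ℝ) + 1)) ^ (-((m : ℝ) / 2)) := by
      refine Continuous.rpow_const (by fun_prop) fun z => Or.inl ?_
      positivity
    exact this.measurable.ennreal_ofReal
  calc ∫⁻ z in ball x r, kern m z y = ∫⁻ z in ball x r, liminf (fun k => f k z) atTop := by
        refine lintegral_congr_ae (ae_restrict_of_ae ?_)
        have : ∀ᵐ z : EuclideanSpace ℝ (Fin (m + 2)), z ≠ y :=
          measure_eq_zero_iff_ae_notMem.1 (measure_singleton y)
        filter_upwards [this] with z hz using ((hlim z hz).liminf_eq).symm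
    _ ≤ liminf (fun k => ∫⁻ z in ball x r, f k z) atTop := lintegral_liminf_le hmeas
    _ ≤ liminf (fun _ : ℕ => volume (ball x r) * kern m x y) atTop := by
        refine liminf_le_liminf (Eventually.of_forall fun k => ?_)
        refine (lintegral_ball_shifted_pow_le m (by positivity) x y hr).trans ?_
        refine mul_le_mul_right ?_ _
        rw [kern_eq_ofReal_rpow m hxy]
        refine ENNReal.ofReal_le_ofReal ?_
        have : 0 < ‖x - y‖ := norm_pos_iff.2 (sub_ne_zero.2 hxy)
        refine Real.rpow_le_rpow_of_nonpos (by positivity) ?_ ?_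
        · have : (0 : ℝ) ≤ 1 / ((k : ℝ) + 1) := by positivity
          linarith
        · have : (0 : ℝ) ≤ m := Nat.cast_nonneg m
          linarith
    _ = volume (ball x r) * kern m x y := liminf_const _

end Kernel

section Potential

variable {d : ℕ}

/-- The integral `∫ h (x - y) dM(y)`. -/
def measConv {F : Type*} [NormedAddCommGroup F] [NormedSpace ℝ F]
    (M : Measure (EuclideanSpace ℝ (Fin d))) (h : EuclideanSpace ℝ (Fin d) → F)
    (x : EuclideanSpace ℝ (Fin d)) : F := ∫ y, h (x - y) ∂M

lemma exists_bound_near {F : Type*} [NormedAddCommGroup F]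
    {S : Set (EuclideanSpace ℝ (Fin d))} (hS : IsCompact S)
    {h : EuclideanSpace ℝ (Fin d) → F} (hh : Continuous h) (x : EuclideanSpace ℝ (Fin d)) :
    ∃ C : ℝ, ∀ z ∈ ball x 1, ∀ y ∈ S, ‖h (z - y)‖ ≤ C := by
  obtain ⟨C, hC⟩ := ((isCompact_closedBall x 1).prod hS).exists_bound_of_continuousOn
    (f := fun q => h (q.1 - q.2)) (by fun_prop)
  exact ⟨C, fun z hz y hy => hC (z, y) ⟨ball_subset_closedBall hz, hy⟩⟩

variable {F : Type*} [NormedAddCommGroup F] [NormedSpace ℝ F]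
  {M : Measure (EuclideanSpace ℝ (Fin d))} [IsFiniteMeasure M]
  {S : Set (EuclideanSpace ℝ (Fin d))}

omit [NormedSpace ℝ F] in
lemma integrable_sub_of_compact (hS : IsCompact S) (hM : ∀ᵐ y ∂M, y ∈ S)
    {h : EuclideanSpace ℝ (Fin d) → F} (hh : Continuous h) (x : EuclideanSpace ℝ (Fin d)) :
    Integrable (fun y => h (x - y)) M := by
  obtain ⟨C, hC⟩ := exists_bound_near hS hh x
  refine Integrable.of_bound (hh.comp (by fun_prop)).aestronglyMeasurable C ?_
  filter_upwards [hM] with y hy using hC x (mem_ball_self one_pos) y hy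

lemma continuous_measConv (hS : IsCompact S) (hM : ∀ᵐ y ∂M, y ∈ S)
    {h : EuclideanSpace ℝ (Fin d) → F} (hh : Continuous h) : Continuous (measConv M h) := by
  refine continuous_iff_continuousAt.2 fun x => ?_
  obtain ⟨C, hC⟩ := exists_bound_near hS hh x
  refine continuousAt_of_dominated (bound := fun _ => C) (Eventually.of_forall fun z =>
    (hh.comp (by fun_prop)).aestronglyMeasurable) ?_ (integrable_const C)
    (Eventually.of_forall fun y => ?_)
  · filter_upwards [ball_mem_nhds x one_pos] with z hz
    filter_upwards [hM] with y hy using hC z hz y hy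
  · exact (hh.comp (by fun_prop)).continuousAt

lemma hasFDerivAt_measConv (hS : IsCompact S) (hM : ∀ᵐ y ∂M, y ∈ S)
    {h : EuclideanSpace ℝ (Fin d) → F} (hh : ContDiff ℝ 1 h) (x : EuclideanSpace ℝ (Fin d)) :
    HasFDerivAt (measConv M h) (measConv M (fderiv ℝ h) x) x := by
  have hc' : Continuous (fderiv ℝ h) := hh.continuous_fderiv (by norm_num)
  obtain ⟨C, hC⟩ := exists_bound_near hS hc' x
  refine hasFDerivAt_integral_of_dominated_of_fderiv_le (s := ball x 1)
    (F := fun x y => h (x - y)) (F' := fun x y => fderiv ℝ h (x - y))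
    (bound := fun _ => C) (ball_mem_nhds x one_pos)
    (Eventually.of_forall fun z => (hh.continuous.comp (by fun_prop)).aestronglyMeasurable)
    (integrable_sub_of_compact hS hM hh.continuous x)
    (hc'.comp (by fun_prop)).aestronglyMeasurable ?_ (integrable_const C) ?_
  · filter_upwards [hM] with y hy z hz using hC z hz y hy
  · refine Eventually.of_forall fun y z _ => ?_
    have h1 := (hh.differentiable (by norm_num) (z - y)).hasFDerivAt
    have h2 : HasFDerivAt (fun w : EuclideanSpace ℝ (Fin d) => w - y)
      (ContinuousLinearMap.id ℝ _) z := (hasFDerivAt_id z).sub_const y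
    exact h1.comp z h2

lemma contDiff_one_measConv (hS : IsCompact S) (hM : ∀ᵐ y ∂M, y ∈ S)
    {h : EuclideanSpace ℝ (Fin d) → F} (hh : ContDiff ℝ 1 h) : ContDiff ℝ 1 (measConv M h) := by
  rw [contDiff_one_iff_fderiv]
  refine ⟨fun x => (hasFDerivAt_measConv hS hM hh x).differentiableAt, ?_⟩
  have : fderiv ℝ (measConv M h) = measConv M (fderiv ℝ h) :=
    funext fun x => (hasFDerivAt_measConv hS hM hh x).fderiv
  rw [this]
  exact continuous_measConv hS hM (hh.continuous_fderiv (by norm_num))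

lemma contDiff_two_measConv (hS : IsCompact S) (hM : ∀ᵐ y ∂M, y ∈ S)
    {h : EuclideanSpace ℝ (Fin d) → F} (hh : ContDiff ℝ 2 h) : ContDiff ℝ 2 (measConv M h) := by
  have h1 : ContDiff ℝ 1 h := hh.of_le (by norm_num)
  rw [show (2 : WithTop ℕ∞) = 1 + 1 by norm_num, contDiff_succ_iff_fderiv]
  refine ⟨fun x => (hasFDerivAt_measConv hS hM h1 x).differentiableAt, by simp, ?_⟩
  have : fderiv ℝ (measConv M h) = measConv M (fderiv ℝ h) :=
    funext fun x => (hasFDerivAt_measConv hS hM h1 x).fderiv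
  rw [this]
  exact contDiff_one_measConv hS hM (hh.fderiv_right (by norm_num))

lemma fderiv_measConv_apply (hS : IsCompact S) (hM : ∀ᵐ y ∂M, y ∈ S)
    {h : EuclideanSpace ℝ (Fin d) → ℝ} (hh : ContDiff ℝ 1 h) (v x : EuclideanSpace ℝ (Fin d)) :
    fderiv ℝ (measConv M h) x v = measConv M (fun z => fderiv ℝ h z v) x := by
  rw [(hasFDerivAt_measConv hS hM hh x).fderiv]
  exact ContinuousLinearMap.integral_apply
    (integrable_sub_of_compact hS hM (hh.continuous_fderiv (by norm_num)) x) v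

lemma lapl_measConv (hS : IsCompact S) (hM : ∀ᵐ y ∂M, y ∈ S)
    {h : EuclideanSpace ℝ (Fin d) → ℝ} (hh : ContDiff ℝ 2 h) (x : EuclideanSpace ℝ (Fin d)) :
    lapl d (measConv M h) x = measConv M (lapl d h) x := by
  have h1 : ContDiff ℝ 1 h := hh.of_le (by norm_num)
  have hi : ∀ i : Fin d, (fun y => fderiv ℝ (measConv M h) y (EuclideanSpace.single i 1)) =
      measConv M (fun z => fderiv ℝ h z (EuclideanSpace.single i 1)) := fun i =>
    funext fun y => fderiv_measConv_apply hS hM h1 _ y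
  simp only [lapl, hi]
  simp_rw [fun i : Fin d => fderiv_measConv_apply hS hM
    (hh.contDiff_fderiv_apply_one (EuclideanSpace.single i 1)) (EuclideanSpace.single i 1) x]
  simp only [measConv]
  rw [← integral_finsetSum]
  · rfl
  · intro i _
    exact integrable_sub_of_compact hS hM
      (h := fun z => fderiv ℝ (fun z => fderiv ℝ h z (EuclideanSpace.single i 1)) z
        (EuclideanSpace.single i 1))
      (((hh.contDiff_fderiv_apply_one (EuclideanSpace.single i 1)).continuous_fderiv
      (by norm_num)).clm_apply continuous_const) x

/-- The Newtonian potential of a measure. -/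
def pot (m : ℕ) (M : Measure (EuclideanSpace ℝ (Fin d))) (x : EuclideanSpace ℝ (Fin d)) :
    ENNReal := ∫⁻ y, kern m x y ∂M

lemma measurable_kern_left (m : ℕ) (y : EuclideanSpace ℝ (Fin d)) :
    Measurable fun x => kern m x y :=
  ((continuous_kern m).comp (by fun_prop : Continuous fun x => (x, y))).measurable

lemma measurable_kern_right (m : ℕ) (x : EuclideanSpace ℝ (Fin d)) :
    Measurable fun y => kern m x y :=
  ((continuous_kern m).comp (by fun_prop : Continuous fun y => (x, y))).measurable

omit [IsFiniteMeasure M] in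
lemma lowerSemicontinuous_pot (m : ℕ) : LowerSemicontinuous (pot m M) := by
  rw [lowerSemicontinuous_iff_isClosed_preimage]
  intro c
  refine IsSeqClosed.isClosed fun u x hu hx => ?_
  simp only [mem_preimage, mem_Iic] at hu ⊢
  calc pot m M x = ∫⁻ y, liminf (fun k => kern m (u k) y) atTop ∂M := by
        refine lintegral_congr fun y => ?_
        have : Continuous fun x => kern m x y :=
          (continuous_kern m).comp (by fun_prop : Continuous fun x => (x, y))
        exact ((this.tendsto x).comp hx).liminf_eq.symm
    _ ≤ liminf (fun k => pot m M (u k)) atTop :=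
        lintegral_liminf_le fun k => measurable_kern_right m (u k)
    _ ≤ liminf (fun _ : ℕ => c) atTop := liminf_le_liminf (Eventually.of_forall hu)
    _ = c := liminf_const c

lemma lintegral_ball_pot_le {m : ℕ} (hm : m ≠ 0) {M : Measure (EuclideanSpace ℝ (Fin (m + 2)))}
    [IsFiniteMeasure M] (x : EuclideanSpace ℝ (Fin (m + 2))) {r : ℝ} (hr : 0 < r) :
    ∫⁻ z in ball x r, pot m M z ≤ volume (ball x r) * pot m M x := by
  unfold pot
  rw [lintegral_lintegral_swap ((continuous_kern m).measurable.aemeasurable)]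
  calc _ ≤ ∫⁻ y, volume (ball x r) * kern m x y ∂M :=
        lintegral_mono fun y => lintegral_ball_kern_le hm x y hr
    _ = _ := lintegral_const_mul _ (measurable_kern_right m x)

lemma pot_local_harmonic {m : ℕ} {M : Measure (EuclideanSpace ℝ (Fin (m + 2)))}
    [IsFiniteMeasure M] {S : Set (EuclideanSpace ℝ (Fin (m + 2)))}
    (hS : IsCompact S) (hM : ∀ᵐ y ∂M, y ∈ S) {x : EuclideanSpace ℝ (Fin (m + 2))} (hx : x ∉ S) :
    ∃ g : EuclideanSpace ℝ (Fin (m + 2)) → ℝ, ContDiff ℝ 2 g ∧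
      lapl (m + 2) g x = 0 ∧ ∀ᶠ z in nhds x, pot m M z = ENNReal.ofReal (g z) ∧ 0 ≤ g z := by
  obtain ⟨δ, hδ, hδS⟩ := Metric.isOpen_iff.1 hS.isClosed.isOpen_compl x hx
  let χ : ContDiffBump (0 : EuclideanSpace ℝ (Fin (m + 2))) :=
    ⟨δ / 4, δ / 3, by positivity, by linarith⟩
  let k : EuclideanSpace ℝ (Fin (m + 2)) → ℝ := fun w => (‖w - 0‖ ^ 2 + 0) ^ (-((m : ℝ) / 2))
  let h : EuclideanSpace ℝ (Fin (m + 2)) → ℝ := fun w => (1 - χ w) * k w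
  have hh : ContDiff ℝ 2 h := by
    rw [contDiff_iff_contDiffAt]
    intro w
    rcases eq_or_ne w 0 with rfl | hw
    · have : h =ᶠ[nhds 0] fun _ => 0 := by
        filter_upwards [χ.eventuallyEq_one] with z hz
        simp [h, hz]
      exact contDiffAt_const.congr_of_eventuallyEq this
    · refine (contDiffAt_const.sub χ.contDiff.contDiffAt).mul
        (contDiffAt_shifted_pow _ 0 0 w ?_ 2)
      have : 0 < ‖w‖ := norm_pos_iff.2 hw
      simpa using by positivity
  have hk : ∀ w, δ / 3 ≤ ‖w‖ → h w = k w := fun w hw => by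
    have : χ w = 0 := χ.zero_of_le_dist (by simpa using hw)
    simp [h, this]
  have hlap : ∀ w, δ / 3 < ‖w‖ → lapl (m + 2) h w = 0 := by
    intro w hw
    have : h =ᶠ[nhds w] k := by
      filter_upwards [(isOpen_lt continuous_const continuous_norm).mem_nhds hw] with z hz
      exact hk z (le_of_lt hz)
    rw [lapl_congr this, lapl_shifted_pow _ 0 (by push_cast; ring) 0 w]
    · ring
    · have : 0 < ‖w‖ := lt_trans (by positivity) hw
      simpa using by positivity
  have hk0 : ∀ w, 0 ≤ k w := fun w => Real.rpow_nonneg (by positivity) _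
  have hdist : ∀ z ∈ ball x (δ / 2), ∀ y ∈ S, δ / 3 < ‖z - y‖ := by
    intro z hz y hy
    have h1 : δ ≤ dist y x := by
      by_contra hcon
      exact hδS (mem_ball.2 (not_le.1 hcon)) hy
    have h2 := dist_triangle y z x
    rw [mem_ball] at hz
    rw [← dist_eq_norm, dist_comm]
    linarith
  refine ⟨measConv M h, contDiff_two_measConv hS hM hh, ?_, ?_⟩
  · rw [lapl_measConv hS hM hh]
    refine integral_eq_zero_of_ae ?_
    filter_upwards [hM] with y hy using hlap _ (hdist x (mem_ball_self (by positivity)) y hy)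
  · filter_upwards [ball_mem_nhds x (by positivity : 0 < δ / 2)] with z hz
    have hnn : 0 ≤ᵐ[M] fun y => h (z - y) := by
      filter_upwards [hM] with y hy
      rw [hk _ (hdist z hz y hy).le]
      exact hk0 _
    refine ⟨?_, integral_nonneg_of_ae hnn⟩
    rw [measConv, ofReal_integral_eq_lintegral_ofReal
      (integrable_sub_of_compact hS hM hh.continuous z) hnn, pot]
    refine lintegral_congr_ae ?_
    filter_upwards [hM] with y hy
    have hzy : z ≠ y := by
      rintro rfl
      have := hdist z hz z hy
      simp at this
      linarith
    rw [hk _ (hdist z hz y hy).le, kern_eq_ofReal_rpow m hzy]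
    simp [k]

lemma pot_toReal_harmonic {m : ℕ} {M : Measure (EuclideanSpace ℝ (Fin (m + 2)))}
    [IsFiniteMeasure M] {S : Set (EuclideanSpace ℝ (Fin (m + 2)))}
    (hS : IsCompact S) (hM : ∀ᵐ y ∂M, y ∈ S) :
    IsHarmonicOnSet (m + 2) (fun x => (pot m M x).toReal) Sᶜ := by
  have key : ∀ x ∈ Sᶜ, ∃ g : EuclideanSpace ℝ (Fin (m + 2)) → ℝ, ContDiff ℝ 2 g ∧
      lapl (m + 2) g x = 0 ∧ (fun x => (pot m M x).toReal) =ᶠ[nhds x] g := by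
    intro x hx
    obtain ⟨g, hg, hl, he⟩ := pot_local_harmonic hS hM hx
    exact ⟨g, hg, hl, he.mono fun z hz => by simp only [hz.1, ENNReal.toReal_ofReal hz.2]⟩
  refine ⟨fun x hx => ?_, fun x hx => ?_⟩ <;> obtain ⟨g, hg, hl, he⟩ := key x hx
  · exact (hg.contDiffAt.congr_of_eventuallyEq he).contDiffWithinAt
  · rw [lapl_congr he, hl]

lemma continuousAt_pot_of_notMem {m : ℕ} {M : Measure (EuclideanSpace ℝ (Fin (m + 2)))}
    [IsFiniteMeasure M] {S : Set (EuclideanSpace ℝ (Fin (m + 2)))}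
    (hS : IsCompact S) (hM : ∀ᵐ y ∂M, y ∈ S) {x : EuclideanSpace ℝ (Fin (m + 2))} (hx : x ∉ S) :
    ContinuousAt (pot m M) x ∧ pot m M x ≠ ⊤ := by
  obtain ⟨g, hg, -, he⟩ := pot_local_harmonic hS hM hx
  refine ⟨?_, ?_⟩
  · exact (ENNReal.continuous_ofReal.comp hg.continuous).continuousAt.congr
      (he.mono fun z hz => hz.1.symm)
  · rw [he.self_of_nhds.1]
    exact ENNReal.ofReal_ne_top

end Potential

section Energy

/-- Integration against a nonnegative continuous function is lower semicontinuous for the weak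
topology on probability measures. -/
lemma lowerSemicontinuous_lintegral {Ω : Type*} [TopologicalSpace Ω] [MeasurableSpace Ω]
    [OpensMeasurableSpace Ω] {G : Ω → ENNReal} (hG : Continuous G) :
    LowerSemicontinuous fun μ : ProbabilityMeasure Ω => ∫⁻ x, G x ∂(μ : Measure Ω) := by
  have hlt : ∀ (N : ℕ) x, min (G x) N ≠ ⊤ := fun N x =>
    ((min_le_right _ _).trans_lt (ENNReal.natCast_lt_top N)).ne
  have hmin : ∀ N : ℕ, Continuous fun x => min (G x) (N : ENNReal) := fun N =>
    hG.min continuous_const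
  let g : ℕ → BoundedContinuousFunction Ω NNReal := fun N =>
    BoundedContinuousFunction.mkOfBound
      ⟨fun x => (min (G x) N).toNNReal, continuous_iff_continuousAt.2 fun x =>
        (ENNReal.tendsto_toNNReal (hlt N x)).comp (hmin N).continuousAt⟩ N (by
        intro x y
        have hb : ∀ z, ((min (G z) N).toNNReal : ℝ) ≤ N := fun z => by
          have : (min (G z) N).toNNReal ≤ (N : NNReal) :=
            ENNReal.toNNReal_mono (ENNReal.natCast_ne_top N) (min_le_right _ _)
          exact_mod_cast this
        rw [NNReal.dist_eq, abs_le]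
        have h1 := hb x
        have h2 := hb y
        have h3 := NNReal.coe_nonneg (min (G x) N).toNNReal
        have h4 := NNReal.coe_nonneg (min (G y) N).toNNReal
        constructor <;> simp only [ContinuousMap.coe_mk] <;> linarith)
  have hgG : ∀ N x, (g N x : ENNReal) = min (G x) N := fun N x => ENNReal.coe_toNNReal (hlt N x)
  have hsup : (fun μ : ProbabilityMeasure Ω => ∫⁻ x, G x ∂(μ : Measure Ω)) =
      fun μ : ProbabilityMeasure Ω => ⨆ N, ∫⁻ x, g N x ∂(μ : Measure Ω) := by
    funext μ
    rw [← lintegral_iSup]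
    · refine lintegral_congr fun x => ?_
      simp only [hgG]
      refine le_antisymm ?_ (iSup_le fun N => min_le_left _ _)
      rcases eq_or_ne (G x) ⊤ with h | h
      · simp [h, ENNReal.iSup_natCast]
      · obtain ⟨N, hN⟩ := ENNReal.exists_nat_gt h
        exact le_iSup_of_le N (le_min le_rfl hN.le)
    · intro N
      simp only [hgG]
      exact (hmin N).measurable
    · intro a b hab x
      simp only [hgG]
      gcongr
  rw [hsup]
  refine lowerSemicontinuous_iSup fun N => Continuous.lowerSemicontinuous ?_
  have := (ENNReal.continuous_coe.comp
    (ProbabilityMeasure.continuous_testAgainstNN_eval (g N)))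
  refine this.congr fun μ => ?_
  simp only [Function.comp]
  exact FiniteMeasure.testAgainstNN_coe_eq

/-- The interaction energy with kernel `|x - y|⁻ᵐ`. -/
def interaction (m : ℕ) {X : Type*} [PseudoEMetricSpace X] [MeasurableSpace X]
    (μ ν : Measure X) : ENNReal := ∫⁻ x, ∫⁻ y, kern m x y ∂ν ∂μ

variable {X : Type*} [MetricSpace X] [MeasurableSpace X] [BorelSpace X]
  [SecondCountableTopology X] {m : ℕ}

lemma measurable_lintegral_kern (ν : Measure X) [SFinite ν] :
    Measurable fun x => ∫⁻ y, kern m x y ∂ν :=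
  (continuous_kern m).measurable.lintegral_prod_right

lemma interaction_comm (μ ν : Measure X) [SFinite μ] [SFinite ν] :
    interaction m μ ν = interaction m ν μ := by
  unfold interaction
  rw [lintegral_lintegral_swap (continuous_kern m).aemeasurable]
  simp_rw [kern_comm m]

lemma lowerSemicontinuous_energy {Q : X → ENNReal} (hQ : Continuous Q) :
    LowerSemicontinuous fun μ : ProbabilityMeasure X =>
      interaction m (μ : Measure X) μ + 2 * ∫⁻ x, Q x ∂(μ : Measure X) := by
  refine LowerSemicontinuous.add ?_ ?_
  · have h1 := lowerSemicontinuous_lintegral (continuous_kern (X := X) m)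
    have h2 : Continuous fun μ : ProbabilityMeasure X => μ.prod μ :=
      ProbabilityMeasure.continuous_prod.comp (by fun_prop : Continuous fun μ => (μ, μ))
    have h3 := h1.comp h2
    refine (iff_of_eq (congrArg _ (funext fun μ => ?_))).1 h3
    simp only [Function.comp, ProbabilityMeasure.toMeasure_prod, interaction]
    exact lintegral_prod _ (continuous_kern m).aemeasurable
  · have : (fun μ : ProbabilityMeasure X => 2 * ∫⁻ x, Q x ∂(μ : Measure X)) =
        fun μ : ProbabilityMeasure X => ∫⁻ x, 2 * Q x ∂(μ : Measure X) :=
      funext fun μ => (lintegral_const_mul _ hQ.measurable).symm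
    rw [this]
    exact lowerSemicontinuous_lintegral
      ((ENNReal.continuous_const_mul (by norm_num)).comp hQ)

lemma exists_energy_minimizer {Q : X → ENNReal} (hQ : Continuous Q) {K : Set X}
    (hK : IsCompact K) (hne : K.Nonempty) :
    ∃ μ : Measure X, IsProbabilityMeasure μ ∧ μ Kᶜ = 0 ∧
      ∀ ν : Measure X, IsProbabilityMeasure ν → ν Kᶜ = 0 →
        interaction m μ μ + 2 * ∫⁻ x, Q x ∂μ ≤ interaction m ν ν + 2 * ∫⁻ x, Q x ∂ν := by
  have hc := isCompact_setOfPred_probabilityMeasure_mass_eq_compl_isCompact_le (E := X)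
    (u := fun _ => 0) (K := fun _ => K) tendsto_const_nhds (fun _ => hK)
    (Or.inl inferInstance)
  have key : ∀ μ : ProbabilityMeasure X, (∀ _n : ℕ, μ Kᶜ ≤ 0) ↔ (μ : Measure X) Kᶜ = 0 := by
    intro μ
    simp [ProbabilityMeasure.null_iff_toMeasure_null]
  obtain ⟨x, hx⟩ := hne
  obtain ⟨μ, hμ, hmin⟩ := LowerSemicontinuousOn.exists_isMinOn
    (s := {μ : ProbabilityMeasure X | ∀ _n : ℕ, μ Kᶜ ≤ 0})
    ⟨⟨Measure.dirac x, inferInstance⟩, (key _).2 (by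
      simp [Measure.dirac_apply' x hK.isClosed.measurableSet.compl, hx])⟩ hc
    ((lowerSemicontinuous_energy (m := m) hQ).lowerSemicontinuousOn _)
  refine ⟨μ, inferInstance, (key μ).1 hμ, fun ν hν hν0 => ?_⟩
  exact hmin (a := ⟨ν, hν⟩) ((key ⟨ν, hν⟩).2 hν0)

/-- Euler–Lagrange inequality for minimizers of the energy. -/
lemma energy_variation {Q : X → ENNReal} (hQ : Measurable Q) {K : Set X}
    {μ : Measure X} [IsProbabilityMeasure μ] (hμK : μ Kᶜ = 0)
    (hmin : ∀ ν : Measure X, IsProbabilityMeasure ν → ν Kᶜ = 0 →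
      interaction m μ μ + 2 * ∫⁻ x, Q x ∂μ ≤ interaction m ν ν + 2 * ∫⁻ x, Q x ∂ν)
    (hfin : interaction m μ μ + 2 * ∫⁻ x, Q x ∂μ ≠ ⊤)
    {ν : Measure X} [IsProbabilityMeasure ν] (hνK : ν Kᶜ = 0) (hν : interaction m ν ν ≠ ⊤) :
    interaction m μ μ + ∫⁻ x, Q x ∂μ ≤ ∫⁻ x, (∫⁻ y, kern m x y ∂μ + Q x) ∂ν := by
  rw [lintegral_add_right _ hQ]
  change _ ≤ interaction m ν μ + _
  by_cases hb : interaction m ν μ = ⊤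
  · simp [hb]
  by_cases hV : ∫⁻ x, Q x ∂ν = ⊤
  · simp [hV]
  have ha : interaction m μ μ ≠ ⊤ := fun h => hfin (by simp [h])
  have hU : ∫⁻ x, Q x ∂μ ≠ ⊤ := fun h => hfin (by simp [h])
  have hb' := interaction_comm (m := m) μ ν
  have hexp : ∀ s t : ENNReal, interaction m (s • μ + t • ν) (s • μ + t • ν) =
      s * s * interaction m μ μ + 2 * (s * t) * interaction m ν μ +
        t * t * interaction m ν ν := by
    intro s t
    have h0 : ∀ x, ∫⁻ y, kern m x y ∂(s • μ + t • ν) =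
        s * ∫⁻ y, kern m x y ∂μ + t * ∫⁻ y, kern m x y ∂ν := fun x => by
      simp [lintegral_add_measure, lintegral_smul_measure]
    have h1 := measurable_lintegral_kern (m := m) μ
    have h2 := measurable_lintegral_kern (m := m) ν
    have e : ∀ ρ : Measure X, ∫⁻ x, (s * ∫⁻ y, kern m x y ∂μ + t * ∫⁻ y, kern m x y ∂ν) ∂ρ =
        s * interaction m ρ μ + t * interaction m ρ ν := fun ρ => by
      rw [lintegral_add_left (h1.const_mul s), lintegral_const_mul _ h1, lintegral_const_mul _ h2]
      rfl
    rw [interaction]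
    simp_rw [h0]
    rw [lintegral_add_measure, lintegral_smul_measure, lintegral_smul_measure, e, e, hb']
    simp only [smul_eq_mul]
    ring
  set a := (interaction m μ μ).toReal with ha'
  set b := (interaction m ν μ).toReal with hbdef
  set c := (interaction m ν ν).toReal with hc'
  set U := (∫⁻ x, Q x ∂μ).toReal with hU'
  set V := (∫⁻ x, Q x ∂ν).toReal with hV'
  have ea : interaction m μ μ = ENNReal.ofReal a := (ENNReal.ofReal_toReal ha).symm
  have eb : interaction m ν μ = ENNReal.ofReal b := (ENNReal.ofReal_toReal hb).symm
  have ec : interaction m ν ν = ENNReal.ofReal c := (ENNReal.ofReal_toReal hν).symm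
  have eU : ∫⁻ x, Q x ∂μ = ENNReal.ofReal U := (ENNReal.ofReal_toReal hU).symm
  have eV : ∫⁻ x, Q x ∂ν = ENNReal.ofReal V := (ENNReal.ofReal_toReal hV).symm
  have a0 : 0 ≤ a := ENNReal.toReal_nonneg
  have b0 : 0 ≤ b := ENNReal.toReal_nonneg
  have c0 : 0 ≤ c := ENNReal.toReal_nonneg
  have U0 : 0 ≤ U := ENNReal.toReal_nonneg
  have V0 : 0 ≤ V := ENNReal.toReal_nonneg
  have hvar : ∀ t ∈ Ioo (0 : ℝ) 1, a + 2 * U ≤ (1 - t) * (1 - t) * a + 2 * ((1 - t) * t) * b +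
      t * t * c + 2 * ((1 - t) * U + t * V) := by
    rintro t ⟨ht0, ht1⟩
    have hs : 0 ≤ 1 - t := by linarith
    have h2 : (2 : ENNReal) = ENNReal.ofReal 2 := by simp
    have hprob : IsProbabilityMeasure (ENNReal.ofReal (1 - t) • μ + ENNReal.ofReal t • ν) := ⟨by
      simp [← ENNReal.ofReal_add hs ht0.le]⟩
    have := hmin (ENNReal.ofReal (1 - t) • μ + ENNReal.ofReal t • ν) hprob (by simp [hμK, hνK])
    rw [hexp, lintegral_add_measure, lintegral_smul_measure, lintegral_smul_measure, ea, eb, ec,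
      eU, eV, h2] at this
    simp only [smul_eq_mul] at this
    simp only [← ENNReal.ofReal_mul, hs, ht0.le, mul_nonneg, zero_le_two] at this
    have h3 : 0 ≤ 2 * ((1 - t) * t) := by positivity
    rw [← ENNReal.ofReal_add (by positivity) (by positivity),
      ← ENNReal.ofReal_add (by positivity) (by positivity),
      ← ENNReal.ofReal_mul zero_le_two, ← ENNReal.ofReal_mul h3,
      ← ENNReal.ofReal_add (by positivity) (by positivity),
      ← ENNReal.ofReal_add (by positivity) (by positivity),
      ← ENNReal.ofReal_add (by positivity) (by positivity),
      ENNReal.ofReal_le_ofReal_iff (by positivity)] at this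
    exact this
  have hlim : a + U ≤ b + V := by
    have h1 : ∀ t ∈ Ioo (0 : ℝ) 1, 0 ≤ -2 * a + t * a + 2 * (1 - t) * b + t * c - 2 * U + 2 * V := by
      intro t ht
      have := hvar t ht
      by_contra! hneg
      nlinarith [mul_neg_of_pos_of_neg ht.1 hneg]
    have h2 : Tendsto (fun t : ℝ => -2 * a + t * a + 2 * (1 - t) * b + t * c - 2 * U + 2 * V)
        (nhdsWithin 0 (Ioi 0)) (nhds (-2 * a + 0 * a + 2 * (1 - 0) * b + 0 * c - 2 * U + 2 * V)) :=
      (Continuous.tendsto (by fun_prop) 0).mono_left nhdsWithin_le_nhds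
    have := ge_of_tendsto h2 (by
      filter_upwards [Ioo_mem_nhdsGT (one_pos : (0 : ℝ) < 1)] with t ht using h1 t ht)
    linarith
  rw [ea, eb, eU, eV, ← ENNReal.ofReal_add a0 U0, ← ENNReal.ofReal_add b0 V0]
  exact ENNReal.ofReal_le_ofReal hlim

end Energy

section BallAverages

variable {m : ℕ}

lemma setLIntegral_ball_kern_self (y : EuclideanSpace ℝ (Fin (m + 1))) {r : ℝ} (hr : 0 < r) :
    ∫⁻ w in ball y r, kern m y w = volume (ball y r) * ((m + 1) * (ENNReal.ofReal r)⁻¹ ^ m) := by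
  have hd : Module.finrank ℝ (EuclideanSpace ℝ (Fin (m + 1))) = m + 1 := by simp
  have h1 : ∫⁻ w in ball y r, kern m y w =
      ∫⁻ w in ball (0 : EuclideanSpace ℝ (Fin (m + 1))) r, ENNReal.ofReal (‖w‖⁻¹ ^ m) := by
    have hmp := (measurePreserving_add_left
      (volume : Measure (EuclideanSpace ℝ (Fin (m + 1)))) y).setLIntegral_comp_emb
        (Homeomorph.addLeft y).measurableEmbedding (kern m y) (ball 0 r)
    have himg : (fun z => y + z) '' ball (0 : EuclideanSpace ℝ (Fin (m + 1))) r = ball y r := by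
      simp
    rw [himg] at hmp
    rw [← hmp]
    refine lintegral_congr_ae (ae_restrict_of_ae ?_)
    filter_upwards [Measure.ae_ne volume 0] with w hw
    rw [kern_eq_ofReal m (by simpa using hw)]
    simp
  have h2 : ∀ t ∈ Ioo 0 r, t ^ (Module.finrank ℝ (EuclideanSpace ℝ (Fin (m + 1))) - 1) •
      (t⁻¹ ^ m) = (1 : ℝ) := by
    intro t ht
    rw [hd, Nat.add_sub_cancel, smul_eq_mul, ← mul_pow, mul_inv_cancel₀ ht.1.ne', one_pow]
  have hintg : IntegrableOn (fun w : EuclideanSpace ℝ (Fin (m + 1)) => ‖w‖⁻¹ ^ m) (ball 0 r) := by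
    rw [integrableOn_fun_norm_addHaar volume (f := fun t => t⁻¹ ^ m)]
    rw [integrableOn_congr_fun h2 measurableSet_Ioo]
    exact integrableOn_const (by simp)
  rw [h1, ← ofReal_integral_eq_lintegral_ofReal hintg (ae_of_all _ fun w => by positivity)]
  have h3 : ∫ w in ball (0 : EuclideanSpace ℝ (Fin (m + 1))) r, ‖w‖⁻¹ ^ m =
      ∫ w : EuclideanSpace ℝ (Fin (m + 1)), (Iio r).indicator (fun t => t⁻¹ ^ m) ‖w‖ := by
    rw [← integral_indicator measurableSet_ball]
    refine integral_congr_ae (ae_of_all _ fun w => ?_)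
    simp [indicator]
  rw [h3, integral_fun_norm_addHaar]
  have h4 : ∫ t in Ioi (0 : ℝ), t ^ (Module.finrank ℝ (EuclideanSpace ℝ (Fin (m + 1))) - 1) •
      (Iio r).indicator (fun t => t⁻¹ ^ m) t = r := by
    have : ∀ t, t ^ (Module.finrank ℝ (EuclideanSpace ℝ (Fin (m + 1))) - 1) •
      (Iio r).indicator (fun t => t⁻¹ ^ m) t = (Iio r).indicator (fun t =>
        t ^ (Module.finrank ℝ (EuclideanSpace ℝ (Fin (m + 1))) - 1) • (t⁻¹ ^ m)) t := by
      intro t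
      simp only [indicator]
      split_ifs <;> simp
    simp_rw [this]
    rw [setIntegral_indicator measurableSet_Iio, Ioi_inter_Iio,
      setIntegral_congr_fun measurableSet_Ioo h2]
    simp [hr.le]
  rw [h4, hd, Measure.addHaar_ball_of_pos _ _ hr, hd, ← ENNReal.ofReal_inv_of_pos hr,
    ← ENNReal.ofReal_pow (by positivity)]
  have h5 : volume (ball (0 : EuclideanSpace ℝ (Fin (m + 1))) 1) =
    ENNReal.ofReal (volume.real (ball (0 : EuclideanSpace ℝ (Fin (m + 1))) 1)) :=
    (ofReal_measureReal measure_ball_lt_top.ne).symm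
  have h6 : ((m : ENNReal) + 1) = ENNReal.ofReal (m + 1) := by
    rw [ENNReal.ofReal_add (by positivity) zero_le_one, ENNReal.ofReal_natCast, ENNReal.ofReal_one]
  rw [h5, h6, ← ENNReal.ofReal_mul (by positivity), ← ENNReal.ofReal_mul (by positivity),
    ← ENNReal.ofReal_mul (by positivity)]
  congr 1
  simp only [nsmul_eq_mul, smul_eq_mul]
  push_cast
  rw [pow_succ, inv_pow]
  field_simp

/-- The normalized Lebesgue measure on a ball. -/
def ballMeas (ξ : EuclideanSpace ℝ (Fin (m + 1))) (r : ℝ) :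
    Measure (EuclideanSpace ℝ (Fin (m + 1))) :=
  (volume (ball ξ r))⁻¹ • volume.restrict (ball ξ r)

variable {ξ : EuclideanSpace ℝ (Fin (m + 1))} {r : ℝ}

lemma isProbabilityMeasure_ballMeas (hr : 0 < r) : IsProbabilityMeasure (ballMeas ξ r) := ⟨by
  simp [ballMeas, ENNReal.inv_mul_cancel (measure_ball_pos volume ξ hr).ne'
    measure_ball_lt_top.ne]⟩

lemma ae_ballMeas : ∀ᵐ w ∂ballMeas ξ r, w ∈ ball ξ r :=
  (ae_restrict_mem measurableSet_ball).filter_mono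
    (Measure.ae_smul_measure_le _)

lemma ballMeas_compl {K : Set (EuclideanSpace ℝ (Fin (m + 1)))} (h : ball ξ r ⊆ K) :
    ballMeas ξ r Kᶜ = 0 :=
  (ae_ballMeas (ξ := ξ) (r := r)).mono fun _ hw => h hw

lemma lintegral_ballMeas_le (hr : 0 < r) {f : EuclideanSpace ℝ (Fin (m + 1)) → ENNReal}
    {b : ENNReal} (h : ∀ w ∈ ball ξ r, f w ≤ b) : ∫⁻ w, f w ∂ballMeas ξ r ≤ b := by
  have := isProbabilityMeasure_ballMeas (ξ := ξ) hr
  calc _ ≤ ∫⁻ _, b ∂ballMeas ξ r := lintegral_mono_ae (ae_ballMeas.mono fun w hw => h w hw)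
    _ = b := by simp

lemma lintegral_ballMeas_kern_le_pow (hr : 0 < r) (y : EuclideanSpace ℝ (Fin (m + 1))) :
    ∫⁻ w, kern m y w ∂ballMeas ξ r ≤ (m + 2) * (ENNReal.ofReal r)⁻¹ ^ m := by
  have h0 := (measure_ball_pos volume ξ hr).ne'
  have h1 : volume (ball ξ r) ≠ ⊤ := measure_ball_lt_top.ne
  have hv : volume (ball y r) = volume (ball ξ r) := by
    rw [Measure.addHaar_ball_center, ← Measure.addHaar_ball_center volume ξ]
  rw [ballMeas, lintegral_smul_measure, smul_eq_mul, ENNReal.inv_mul_le_iff h0 h1]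
  calc ∫⁻ w in ball ξ r, kern m y w
      ≤ ∫⁻ w in ball ξ r, ((ball y r).indicator (kern m y) w + (ENNReal.ofReal r)⁻¹ ^ m) := by
        refine lintegral_mono fun w => ?_
        by_cases hw : w ∈ ball y r
        · simp [hw]
        · have : ENNReal.ofReal r ≤ edist y w := by
            rw [edist_dist]
            refine ENNReal.ofReal_le_ofReal ?_
            rw [dist_comm]
            simpa using hw
          refine le_add_left ?_
          unfold kern
          gcongr
    _ ≤ (∫⁻ w in ball y r, kern m y w) + volume (ball ξ r) * (ENNReal.ofReal r)⁻¹ ^ m := by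
        rw [lintegral_add_right _ measurable_const]
        refine add_le_add ?_ (by simp [mul_comm])
        refine (setLIntegral_le_lintegral _ _).trans ?_
        rw [lintegral_indicator measurableSet_ball]
    _ = _ := by
        have := setLIntegral_ball_kern_self y hr
        rw [this, hv]
        ring

lemma lintegral_ballMeas_kern_le (hr : 0 < r) (y : EuclideanSpace ℝ (Fin (m + 1))) :
    ∫⁻ w, kern m y w ∂ballMeas ξ r ≤ (m + 2) * 2 ^ m * kern m y ξ := by
  rcases lt_or_ge (dist y ξ) (2 * r) with h | h
  · refine (lintegral_ballMeas_kern_le_pow hr y).trans ?_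
    rw [mul_assoc]
    gcongr
    rw [kern, ← mul_pow]
    gcongr
    rw [ENNReal.inv_le_iff_inv_le, ENNReal.mul_inv (by simp) (by simp), inv_inv, edist_dist,
      ENNReal.inv_mul_le_iff (by simp) (by simp)]
    refine (ENNReal.ofReal_le_ofReal h.le).trans_eq ?_
    rw [ENNReal.ofReal_mul zero_le_two, ENNReal.ofReal_ofNat]
  · have h1 : ∫⁻ w, kern m y w ∂ballMeas ξ r ≤ 2 ^ m * kern m y ξ := by
      refine lintegral_ballMeas_le hr fun w hw => ?_
      rw [kern, kern, ← mul_pow]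
      gcongr
      rw [ENNReal.inv_le_iff_inv_le, ENNReal.mul_inv (by simp) (by simp), inv_inv, edist_dist,
        edist_dist, ENNReal.inv_mul_le_iff (by simp) (by simp)]
      have := dist_triangle y w ξ
      rw [mem_ball] at hw
      refine (ENNReal.ofReal_le_ofReal (q := 2 * dist y w) (by linarith)).trans_eq ?_
      rw [ENNReal.ofReal_mul zero_le_two, ENNReal.ofReal_ofNat]
    refine h1.trans ?_
    gcongr
    calc (2 : ENNReal) ^ m = 1 * 2 ^ m := (one_mul _).symm
      _ ≤ _ := by
        gcongr
        exact le_add_left (by norm_num)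

lemma interaction_ballMeas_ne_top (hr : 0 < r) :
    interaction m (ballMeas ξ r) (ballMeas ξ r) ≠ ⊤ := by
  refine ne_top_of_le_ne_top ?_ (lintegral_ballMeas_le hr
    fun w _ => lintegral_ballMeas_kern_le_pow hr w)
  exact ENNReal.mul_ne_top (by norm_cast; simp) (ENNReal.pow_ne_top (by simp [hr]))

/-- Averages of a continuous function over shrinking balls do not exceed its value in the limit. -/
lemma eventually_lintegral_ballMeas_le {f : EuclideanSpace ℝ (Fin (m + 1)) → ENNReal}
    (hf : ContinuousAt f ξ) {b : ENNReal} (hb : f ξ < b) {ρ : ℕ → ℝ} (hρ : ∀ k, 0 < ρ k)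
    (hρ0 : Tendsto ρ atTop (nhds 0)) :
    ∀ᶠ k in atTop, ∫⁻ w, f w ∂ballMeas ξ (ρ k) ≤ b := by
  obtain ⟨δ, hδ, hball⟩ := Metric.mem_nhds_iff.1 (hf.eventually (gt_mem_nhds hb))
  filter_upwards [hρ0.eventually (gt_mem_nhds hδ)] with k hk
  exact lintegral_ballMeas_le (hρ k) fun w hw =>
    (hball (ball_subset_ball hk.le hw)).le

/-- A lower bound for the averages of `pot + Q` over small balls passes to the center. -/
lemma le_pot_add_of_average {M : Measure (EuclideanSpace ℝ (Fin (m + 1)))} [IsFiniteMeasure M]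
    (hm : m ≠ 0) {Q : EuclideanSpace ℝ (Fin (m + 1)) → ENNReal} (hQ : Continuous Q) {c : ENNReal}
    (hr : 0 < r)
    (h : ∀ s, 0 < s → s ≤ r → c ≤ ∫⁻ w, (pot m M w + Q w) ∂ballMeas ξ s) :
    c ≤ pot m M ξ + Q ξ := by
  by_cases hp : pot m M ξ = ⊤
  · simp [hp]
  by_cases hc : Q ξ = ⊤
  · simp [hc]
  set ρ : ℕ → ℝ := fun k => r / (k + 1) with hρdef
  have hρ : ∀ k, 0 < ρ k := fun k => by
    simp only [hρdef]
    positivity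
  have hρr : ∀ k, ρ k ≤ r := fun k => div_le_self hr.le (by linarith [k.cast_nonneg (α := ℝ)])
  have hρ0 : Tendsto ρ atTop (nhds 0) := by
    have := (tendsto_one_div_add_atTop_nhds_zero_nat (𝕜 := ℝ)).const_mul r
    simpa [hρdef, div_eq_mul_inv] using this
  have hξ : M {ξ} = 0 := by
    by_contra hne
    refine hp (top_le_iff.1 ?_)
    calc (⊤ : ENNReal) = ∫⁻ y in {ξ}, kern m ξ y ∂M := by
          rw [lintegral_singleton, kern_self hm, ENNReal.top_mul hne]
      _ ≤ _ := setLIntegral_le_lintegral _ _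
  set A : ℕ → EuclideanSpace ℝ (Fin (m + 1)) → ENNReal := fun k y =>
    ∫⁻ w, kern m y w ∂ballMeas ξ (ρ k)
  have hprob := fun k => isProbabilityMeasure_ballMeas (ξ := ξ) (hρ k)
  have hA : ∀ k, Measurable (A k) := fun k => measurable_lintegral_kern _
  have hswap : ∀ k, ∫⁻ w, pot m M w ∂ballMeas ξ (ρ k) = ∫⁻ y, A k y ∂M := fun k => by
    have := hprob k
    exact interaction_comm (ballMeas ξ (ρ k)) M
  have hlim : limsup (fun k => ∫⁻ y, A k y ∂M) atTop ≤ pot m M ξ := by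
    refine (limsup_lintegral_le (fun y => (m + 2) * 2 ^ m * kern m y ξ) hA
      (fun k => ae_of_all _ fun y => lintegral_ballMeas_kern_le (hρ k) y) ?_).trans ?_
    · rw [lintegral_const_mul _ (measurable_kern_left m ξ)]
      simp_rw [kern_comm m _ ξ]
      exact ENNReal.mul_ne_top (ENNReal.mul_ne_top (by norm_cast; simp) (by simp)) hp
    · refine lintegral_mono_ae ?_
      have : ∀ᵐ y ∂M, y ≠ ξ := by
        rw [ae_iff]
        simpa using hξ
      filter_upwards [this] with y hy
      refine le_of_forall_gt fun b hb => ?_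
      obtain ⟨b', hb', hbb⟩ := exists_between hb
      refine lt_of_le_of_lt (limsup_le_of_le (by isBoundedDefault) ?_) hbb
      have hc : Continuous fun w => kern m y w :=
        (continuous_kern m).comp (by fun_prop : Continuous fun w => (y, w))
      exact eventually_lintegral_ballMeas_le hc.continuousAt (by rwa [kern_comm]) hρ hρ0
  refine ENNReal.le_of_forall_pos_le_add fun ε hε _ => ?_
  have hQlt : Q ξ < Q ξ + ε := ENNReal.lt_add_right hc (by exact_mod_cast hε.ne')
  have hev : ∀ᶠ k in atTop, c - (Q ξ + ε) ≤ ∫⁻ y, A k y ∂M := by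
    filter_upwards [eventually_lintegral_ballMeas_le hQ.continuousAt hQlt hρ hρ0] with k hk
    rw [tsub_le_iff_right, ← hswap]
    refine (h _ (hρ k) (hρr k)).trans ?_
    rw [lintegral_add_right _ hQ.measurable]
    gcongr
  have : c - (Q ξ + ε) ≤ pot m M ξ :=
    (le_limsup_of_frequently_le hev.frequently (by isBoundedDefault)).trans hlim
  rw [tsub_le_iff_right] at this
  rwa [add_assoc]

end BallAverages

/-- Existence of an equilibrium measure in a coercive external field, for the kernel
`|x - y|⁻ᵐ` in `ℝ^{m+1}`. -/
theorem exists_equilibrium {m : ℕ} (hm : m ≠ 0) {q : EuclideanSpace ℝ (Fin (m + 1)) → ℝ}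
    (hq : Continuous q)
    (hcoer : Tendsto q (cocompact (EuclideanSpace ℝ (Fin (m + 1)))) atTop) :
    ∃ (M : Measure (EuclideanSpace ℝ (Fin (m + 1)))) (S : Set (EuclideanSpace ℝ (Fin (m + 1))))
      (c : ℝ), IsProbabilityMeasure M ∧ IsCompact S ∧ M Sᶜ = 0 ∧ 0 ≤ c ∧
      (∀ x, ENNReal.ofReal c ≤ pot m M x + ENNReal.ofReal (q x)) ∧
      ∀ x ∈ S, pot m M x + ENNReal.ofReal (q x) = ENNReal.ofReal c := by
  set Q : EuclideanSpace ℝ (Fin (m + 1)) → ENNReal := fun x => ENNReal.ofReal (q x) with hQdef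
  have hQ : Continuous Q := ENNReal.continuous_ofReal.comp hq
  have hp0 := isProbabilityMeasure_ballMeas (ξ := (0 : EuclideanSpace ℝ (Fin (m + 1)))) one_pos
  set ν₀ := ballMeas (0 : EuclideanSpace ℝ (Fin (m + 1))) 1
  set J₀ := interaction m ν₀ ν₀ + 2 * ∫⁻ x, Q x ∂ν₀ with hJ₀
  have hJ₀top : J₀ ≠ ⊤ := by
    obtain ⟨b, hb⟩ := (isCompact_closedBall (0 : EuclideanSpace ℝ (Fin (m + 1))) 1).bddAbove_image
      hq.continuousOn
    refine ENNReal.add_ne_top.2 ⟨interaction_ballMeas_ne_top one_pos,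
      ENNReal.mul_ne_top (by norm_num) (ne_top_of_le_ne_top (ENNReal.ofReal_ne_top (r := b)) ?_)⟩
    exact lintegral_ballMeas_le one_pos fun w hw =>
      ENNReal.ofReal_le_ofReal (hb ⟨w, ball_subset_closedBall hw, rfl⟩)
  obtain ⟨R, hR1, hR⟩ : ∃ R : ℝ, 1 ≤ R ∧ ∀ x, R ≤ ‖x‖ → J₀ ≤ Q x := by
    have h1 := hcoer.eventually_ge_atTop J₀.toReal
    rw [← cobounded_eq_cocompact] at h1
    obtain ⟨R, hR⟩ := (hasBasis_cobounded_norm.eventually_iff).1 h1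
    refine ⟨max R 1, le_max_right _ _, fun x hx => ?_⟩
    have := hR.2 ((le_max_left _ _).trans hx : R ≤ ‖x‖)
    rw [hQdef, ← ENNReal.ofReal_toReal hJ₀top]
    exact ENNReal.ofReal_le_ofReal this
  obtain ⟨M, hM, hMK, hmin⟩ := exists_energy_minimizer (m := m) hQ
    (isCompact_closedBall (0 : EuclideanSpace ℝ (Fin (m + 1))) R) ⟨0, by simp; linarith⟩
  set c := interaction m M M + ∫⁻ x, Q x ∂M with hc
  have hJ : interaction m M M + 2 * ∫⁻ x, Q x ∂M ≤ J₀ := hmin ν₀ hp0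
    (ballMeas_compl ((ball_subset_ball hR1).trans ball_subset_closedBall))
  have hcJ : c ≤ J₀ := by
    refine le_trans ?_ hJ
    rw [two_mul]
    exact add_le_add le_rfl le_add_self
  have hctop : c ≠ ⊤ := ne_top_of_le_ne_top hJ₀top hcJ
  have hge : ∀ x, c ≤ pot m M x + Q x := by
    intro x
    rcases le_or_gt R ‖x‖ with h | h
    · exact (hcJ.trans (hR x h)).trans le_add_self
    · refine le_pot_add_of_average hm hQ (r := R - ‖x‖) (by linarith) fun s hs hsr => ?_
      have := isProbabilityMeasure_ballMeas (ξ := x) hs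
      refine energy_variation hQ.measurable hMK hmin (ne_top_of_le_ne_top hJ₀top hJ)
        (ballMeas_compl fun w hw => ?_) (interaction_ballMeas_ne_top hs)
      rw [mem_ball, dist_eq_norm] at hw
      rw [mem_closedBall_zero_iff]
      have := norm_le_norm_add_norm_sub' w x
      linarith
  have hintg : ∫⁻ x, (pot m M x + Q x) ∂M = c := lintegral_add_right _ hQ.measurable
  have hae : (fun _ => c) =ᵐ[M] fun x => pot m M x + Q x := by
    refine ae_eq_of_ae_le_of_lintegral_le (ae_of_all _ hge) (by simpa using hctop)
      ((measurable_lintegral_kern M).add hQ.measurable).aemeasurable ?_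
    rw [hintg]
    simp
  have hlsc : LowerSemicontinuous fun x => pot m M x + Q x :=
    (lowerSemicontinuous_pot m).add hQ.lowerSemicontinuous
  have hcr : ENNReal.ofReal c.toReal = c := ENNReal.ofReal_toReal hctop
  refine ⟨M, closedBall 0 R ∩ {x | pot m M x + Q x ≤ c}, c.toReal, hM,
    (isCompact_closedBall _ _).inter_right (hlsc.isClosed_preimage c), ?_, ENNReal.toReal_nonneg,
    fun x => hcr.le.trans (hge x), fun x hx => ?_⟩
  · have hK : ∀ᵐ x ∂M, x ∈ closedBall (0 : EuclideanSpace ℝ (Fin (m + 1))) R := hMK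
    have : ∀ᵐ x ∂M, x ∈ closedBall (0 : EuclideanSpace ℝ (Fin (m + 1))) R ∩
        {x | pot m M x + Q x ≤ c} := by
      filter_upwards [hK, hae] with x h1 h2
      exact ⟨h1, h2.ge⟩
    exact this
  · rw [hcr]
    exact le_antisymm hx.2 (hge x)

section Continuity

variable {m : ℕ} {M : Measure (EuclideanSpace ℝ (Fin (m + 2)))} [IsFiniteMeasure M]
  {S : Set (EuclideanSpace ℝ (Fin (m + 2)))}

omit [IsFiniteMeasure M] in
lemma measure_singleton_of_pot_ne_top (hm : m ≠ 0) {x : EuclideanSpace ℝ (Fin (m + 2))}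
    (hx : pot m M x ≠ ⊤) : M {x} = 0 := by
  by_contra hne
  refine hx (top_le_iff.1 ?_)
  calc (⊤ : ENNReal) = ∫⁻ y in {x}, kern m x y ∂M := by
        rw [lintegral_singleton, kern_self hm, ENNReal.top_mul hne]
    _ ≤ _ := setLIntegral_le_lintegral _ _

lemma exists_pot_restrict_ball_lt (hm : m ≠ 0) {x : EuclideanSpace ℝ (Fin (m + 2))}
    (hx : pot m M x ≠ ⊤) {ε : ENNReal} (hε : 0 < ε) :
    ∃ r, 0 < r ∧ pot m (M.restrict (ball x r)) x < ε := by
  have h1 : Tendsto (fun k : ℕ => M (ball x (1 / ((k : ℝ) + 1)))) atTop (nhds 0) := by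
    have := tendsto_measure_iInter_atTop (μ := M) (s := fun k : ℕ => ball x (1 / ((k : ℝ) + 1)))
      (fun k => measurableSet_ball.nullMeasurableSet)
      (fun a b hab => ball_subset_ball (by gcongr)) ⟨0, measure_ne_top _ _⟩
    have hI : ⋂ k : ℕ, ball x (1 / ((k : ℝ) + 1)) = {x} := by
      ext y
      simp only [mem_iInter, mem_ball, mem_singleton_iff]
      refine ⟨fun h => ?_, fun h k => by simp [h]; positivity⟩
      by_contra hne
      obtain ⟨k, hk⟩ := exists_nat_one_div_lt (dist_pos.2 hne)
      exact (h k).not_gt hk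
    rwa [hI, measure_singleton_of_pot_ne_top hm hx] at this
  have h2 := tendsto_setLIntegral_zero (f := kern m x) hx h1
  obtain ⟨k, hk⟩ := (h2.eventually (gt_mem_nhds hε)).exists
  exact ⟨_, by positivity, hk⟩

omit [IsFiniteMeasure M] in
lemma pot_le_of_nearest (hM : ∀ᵐ y ∂M, y ∈ S) {x x' : EuclideanSpace ℝ (Fin (m + 2))}
    (hx : ∀ y ∈ S, dist x x' ≤ dist x y) : pot m M x ≤ 2 ^ m * pot m M x' := by
  unfold pot
  rw [← lintegral_const_mul _ (measurable_kern_right m x')]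
  refine lintegral_mono_ae ?_
  filter_upwards [hM] with y hy
  rw [kern, kern, ← mul_pow]
  gcongr
  rw [ENNReal.inv_le_iff_inv_le, ENNReal.mul_inv (by simp) (by simp), inv_inv, edist_dist,
    edist_dist, ENNReal.inv_mul_le_iff (by simp) (by simp)]
  have h1 := dist_triangle x' x y
  have h2 := hx y hy
  rw [dist_comm x' x] at h1
  refine (ENNReal.ofReal_le_ofReal (q := 2 * dist x y) (by linarith)).trans_eq ?_
  rw [ENNReal.ofReal_mul zero_le_two, ENNReal.ofReal_ofNat]

/-- Evans–Vasilesco: a potential that is finite and continuous on the support of the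
measure is continuous everywhere. -/
lemma continuous_pot (hm : m ≠ 0) (hS : IsCompact S) (hM : ∀ᵐ y ∂M, y ∈ S)
    (hcont : ContinuousOn (pot m M) S) (hfin : ∀ x ∈ S, pot m M x ≠ ⊤) :
    Continuous (pot m M) := by
  refine continuous_iff_continuousAt.2 fun x₀ => ?_
  by_cases hx₀ : x₀ ∉ S
  · exact (continuousAt_pot_of_notMem hS hM hx₀).1
  rw [not_not] at hx₀
  refine continuousAt_iff_lower_upperSemicontinuousAt.2 ⟨lowerSemicontinuous_pot m x₀, ?_⟩
  intro b hb
  obtain ⟨δ, hδ, hδb⟩ := ENNReal.lt_iff_exists_add_pos_lt.1 hb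
  have hδ' : (0 : ENNReal) < δ / 2 := ENNReal.half_pos (by exact_mod_cast hδ.ne')
  have hε : (0 : ENNReal) < δ / 2 / 2 ^ m := ENNReal.div_pos hδ'.ne' (by simp)
  obtain ⟨r, hr, hgx₀⟩ := exists_pot_restrict_ball_lt hm (hfin x₀ hx₀) hε
  set g := pot m (M.restrict (ball x₀ r)) with hg
  set h := pot m (M.restrict (ball x₀ r)ᶜ) with hh
  have hsplit : ∀ x, pot m M x = g x + h x := fun x =>
    (lintegral_add_compl _ measurableSet_ball).symm
  obtain ⟨hhc, hhfin⟩ : ContinuousAt h x₀ ∧ h x₀ ≠ ⊤ :=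
    continuousAt_pot_of_notMem (S := S \ ball x₀ r) (hS.diff isOpen_ball)
      (by
        filter_upwards [ae_restrict_of_ae hM, ae_restrict_mem measurableSet_ball.compl]
          with y h1 h2 using ⟨h1, h2⟩)
      (fun hmem => hmem.2 (mem_ball_self hr))
  have hgS : ∀ᶠ x in nhdsWithin x₀ S, g x < δ / 2 / 2 ^ m := by
    have ht : Tendsto (fun x => pot m M x - h x) (nhdsWithin x₀ S)
        (nhds (pot m M x₀ - h x₀)) :=
      ENNReal.Tendsto.sub (hcont x₀ hx₀) (hhc.tendsto.mono_left nhdsWithin_le_nhds)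
        (Or.inr hhfin)
    have he : pot m M x₀ - h x₀ = g x₀ := by
      rw [hsplit, ENNReal.add_sub_cancel_right hhfin]
    rw [he] at ht
    filter_upwards [ht.eventually (gt_mem_nhds hgx₀), (hhc.tendsto.mono_left
      nhdsWithin_le_nhds).eventually (gt_mem_nhds hhfin.lt_top)] with x hx hx'
    rwa [hsplit, ENNReal.add_sub_cancel_right hx'.ne] at hx
  rw [eventually_nhdsWithin_iff, Metric.eventually_nhds_iff] at hgS
  obtain ⟨η, hη, hgη⟩ := hgS
  have hhev : ∀ᶠ x in nhds x₀, h x < h x₀ + δ / 2 :=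
    hhc.eventually (gt_mem_nhds (ENNReal.lt_add_right hhfin hδ'.ne'))
  filter_upwards [hhev, ball_mem_nhds x₀ (half_pos hη)] with x hx hxη
  obtain ⟨x', hx'S, hx'⟩ := hS.exists_infDist_eq_dist ⟨x₀, hx₀⟩ x
  have hnear : ∀ y ∈ S, dist x x' ≤ dist x y := fun y hy =>
    hx' ▸ infDist_le_dist_of_mem hy
  have hx'x₀ : dist x' x₀ < η := by
    have h1 := dist_triangle x' x x₀
    have h2 := hnear x₀ hx₀
    rw [dist_comm x' x] at h1
    rw [mem_ball] at hxη
    linarith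
  have hgx : g x ≤ δ / 2 := by
    refine (pot_le_of_nearest (ae_restrict_of_ae hM) hnear).trans ?_
    refine (mul_le_mul_right (hgη hx'x₀ hx'S).le _).trans ?_
    rw [ENNReal.mul_div_cancel (by simp) (by simp)]
  refine lt_of_le_of_lt ?_ hδb
  calc pot m M x = g x + h x := hsplit x
    _ ≤ δ / 2 + (h x₀ + δ / 2) := add_le_add hgx hx.le
    _ = h x₀ + δ := by rw [add_comm, add_assoc, ENNReal.add_halves]
    _ ≤ pot m M x₀ + δ := by
      gcongr
      rw [hsplit]
      exact le_add_self

lemma pot_ne_top (hS : IsCompact S) (hM : ∀ᵐ y ∂M, y ∈ S) (hfin : ∀ x ∈ S, pot m M x ≠ ⊤)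
    (x : EuclideanSpace ℝ (Fin (m + 2))) : pot m M x ≠ ⊤ := by
  by_cases hx : x ∈ S
  · exact hfin x hx
  · exact (continuousAt_pot_of_notMem hS hM hx).2

omit [IsFiniteMeasure M] in
lemma pot_le_of_norm_lt [IsProbabilityMeasure M] {ρ : ℝ} (hM : ∀ᵐ y ∂M, ‖y‖ ≤ ρ)
    {x : EuclideanSpace ℝ (Fin (m + 2))} (hx : ρ < ‖x‖) :
    pot m M x ≤ ENNReal.ofReal ((‖x‖ - ρ)⁻¹ ^ m) := by
  have hpos : 0 < ‖x‖ - ρ := by linarith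
  calc pot m M x ≤ ∫⁻ _, ENNReal.ofReal ((‖x‖ - ρ)⁻¹ ^ m) ∂M := by
        refine lintegral_mono_ae ?_
        filter_upwards [hM] with y hy
        have hd : ‖x‖ - ρ ≤ dist x y := by
          rw [dist_eq_norm]
          linarith [norm_sub_norm_le x y]
        rw [kern_eq_ofReal m (dist_pos.1 (hpos.trans_le hd))]
        gcongr
    _ = _ := by simp

omit [IsFiniteMeasure M] in
lemma le_pot_of_norm_le [IsProbabilityMeasure M] (hm : m ≠ 0) {ρ : ℝ} (hρ : 0 < ρ)
    (hM : ∀ᵐ y ∂M, ‖y‖ ≤ ρ) {x : EuclideanSpace ℝ (Fin (m + 2))} (hx : ‖x‖ ≤ ρ) :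
    ENNReal.ofReal ((2 * ρ)⁻¹ ^ m) ≤ pot m M x := by
  calc ENNReal.ofReal ((2 * ρ)⁻¹ ^ m) = ∫⁻ _, ENNReal.ofReal ((2 * ρ)⁻¹ ^ m) ∂M := by simp
    _ ≤ pot m M x := by
        refine lintegral_mono_ae ?_
        filter_upwards [hM] with y hy
        rcases eq_or_ne x y with rfl | hxy
        · simp [kern_self hm]
        have hd : dist x y ≤ 2 * ρ := by
          rw [dist_eq_norm]
          linarith [norm_sub_le x y]
        have := dist_pos.2 hxy
        rw [kern_eq_ofReal m hxy]
        gcongr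

end Continuity

section Comparison

variable {d : ℕ}

/-- A continuous function bounded above by `b` on a ball with average at least `b` is constant. -/
lemma eqOn_ball_of_le_average {v : EuclideanSpace ℝ (Fin d) → ℝ} (hv : Continuous v)
    {x : EuclideanSpace ℝ (Fin d)} {r b : ℝ} (hr : 0 < r) (hb : ∀ y, v y ≤ b)
    (h : b ≤ ⨍ y in ball x r, v y) : EqOn v (fun _ => b) (ball x r) := by
  have hvol : 0 < volume.real (ball x r) :=
    ENNReal.toReal_pos (measure_ball_pos _ _ hr).ne' measure_ball_lt_top.ne
  have hintg : IntegrableOn v (ball x r) :=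
    (hv.continuousOn.integrableOn_compact (isCompact_closedBall _ _)).mono_set ball_subset_closedBall
  rw [setAverage_eq, smul_eq_mul, le_inv_mul_iff₀ hvol] at h
  have hconst : IntegrableOn (fun _ => b) (ball x r) := integrableOn_const measure_ball_lt_top.ne
  have h0 : ∫ y in ball x r, (b - v y) = 0 := by
    refine le_antisymm ?_ (integral_nonneg fun y => sub_nonneg.2 (hb y))
    rw [integral_sub hconst hintg, setIntegral_const, smul_eq_mul]
    linarith
  rw [integral_eq_zero_iff_of_nonneg (fun y => sub_nonneg.2 (hb y)) (hconst.sub hintg)] at h0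
  refine Measure.eqOn_open_of_ae_eq (μ := volume) ?_ isOpen_ball hv.continuousOn
    continuousOn_const
  filter_upwards [h0] with y hy
  simp only [Pi.zero_apply] at hy
  linarith

/-- Comparison principle: `w` subharmonic off a set where `w ≤ u`, `u` superharmonic. -/
lemma le_of_superMeanVal (hd : 0 < d) {u w : EuclideanSpace ℝ (Fin d) → ℝ} (hu : Continuous u)
    (hw : Continuous w) (hsu : SuperMeanVal d u) {Z : Set (EuclideanSpace ℝ (Fin d))}
    (hZ : ∀ x ∈ Z, w x ≤ u x)
    (hsw : ∀ x ∉ Z, ∃ r, 0 < r ∧ w x ≤ ⨍ y in ball x r, w y)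
    (hinf : ∀ ε > 0, ∀ᶠ x in cocompact (EuclideanSpace ℝ (Fin d)), w x - u x < ε)
    (x : EuclideanSpace ℝ (Fin d)) : w x ≤ u x := by
  by_contra! hx
  set v : EuclideanSpace ℝ (Fin d) → ℝ := fun y => w y - u y with hvdef
  have hv : Continuous v := hw.sub hu
  have hvx : 0 < v x := sub_pos.2 hx
  obtain ⟨x₀, hx₀⟩ := hv.exists_forall_ge' x ((hinf _ hvx).mono fun y hy => hy.le)
  have hpos : 0 < v x₀ := hvx.trans_le (hx₀ x)
  have hopen : IsOpen {y | v y = v x₀} := by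
    rw [Metric.isOpen_iff]
    intro y hy
    have hyZ : y ∉ Z := fun h => by
      have := hZ y h
      have h3 : w y - u y = v x₀ := hy
      linarith
    obtain ⟨r, hr, hr'⟩ := hsw y hyZ
    refine ⟨r, hr, eqOn_ball_of_le_average hv hr hx₀ ?_⟩
    have hiw : IntegrableOn w (ball y r) :=
      (hw.continuousOn.integrableOn_compact (isCompact_closedBall _ _)).mono_set ball_subset_closedBall
    have hiu : IntegrableOn u (ball y r) :=
      (hu.continuousOn.integrableOn_compact (isCompact_closedBall _ _)).mono_set ball_subset_closedBall
    have h1 : ⨍ z in ball y r, v z = (⨍ z in ball y r, w z) - ⨍ z in ball y r, u z := by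
      simp only [setAverage_eq, smul_eq_mul, hvdef]
      rw [integral_sub hiw hiu]
      ring
    have h2 := hsu y r hr
    have h3 : w y - u y = v x₀ := hy
    rw [h1]
    linarith
  have huniv : {y | v y = v x₀} = univ :=
    IsClopen.eq_univ ⟨isClosed_eq hv continuous_const, hopen⟩ ⟨x₀, rfl⟩
  have : Nontrivial (EuclideanSpace ℝ (Fin d)) := by
    have : Nonempty (Fin d) := ⟨⟨0, hd⟩⟩
    infer_instance
  have : NoncompactSpace (EuclideanSpace ℝ (Fin d)) := NormedSpace.noncompactSpace ℝ _
  obtain ⟨y, hy⟩ := (hinf _ hpos).exists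
  have : y ∈ {y | v y = v x₀} := huniv ▸ mem_univ y
  exact absurd this hy.ne

/-- Averages over balls under the similarity `y ↦ c • σ y`. -/
lemma setAverage_comp_similarity {f : EuclideanSpace ℝ (Fin d) → ℝ} {c : ℝ} (hc : 0 < c)
    (σ : EuclideanSpace ℝ (Fin d) ≃ₗᵢ[ℝ] EuclideanSpace ℝ (Fin d))
    (x : EuclideanSpace ℝ (Fin d)) {r : ℝ} (hr : 0 < r) :
    ⨍ y in ball x r, f (c • σ y) = ⨍ y in ball (c • σ x) (c * r), f y := by
  have hcr : 0 < c * r := by positivity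
  have hv : ∀ (z : EuclideanSpace ℝ (Fin d)) (s : ℝ), 0 < s → volume.real (ball z s) =
      s ^ d * volume.real (ball (0 : EuclideanSpace ℝ (Fin d)) 1) := by
    intro z s hs
    rw [Measure.real, Measure.addHaar_ball_of_pos _ _ hs, ENNReal.toReal_mul,
      ENNReal.toReal_ofReal (by positivity)]
    simp [Measure.real]
  have hrot : ∫ y in ball (0 : EuclideanSpace ℝ (Fin d)) 1, f (c • σ x + (c * r) • σ y) =
      ∫ y in ball (0 : EuclideanSpace ℝ (Fin d)) 1, f (c • σ x + (c * r) • y) := by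
    have := σ.measurePreserving.setIntegral_preimage_emb σ.toHomeomorph.measurableEmbedding
      (fun y => f (c • σ x + (c * r) • y)) (ball 0 1)
    rw [← this]
    congr 2
    ext y
    simp
  have hlin : ∀ y, c • σ (x + r • y) = c • σ x + (c * r) • σ y := fun y => by
    simp [smul_add, smul_smul]
  rw [setAverage_eq, setAverage_eq, hv x r hr, hv _ _ hcr, setIntegral_ball_eq_unitBall _ x hr,
    setIntegral_ball_eq_unitBall _ _ hcr]
  simp_rw [hlin]
  rw [hrot, smul_eq_mul, smul_eq_mul]
  have h1 : r ^ d ≠ 0 := (pow_pos hr d).ne'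
  have h2 : (c * r) ^ d ≠ 0 := (pow_pos hcr d).ne'
  field_simp

end Comparison

section LaplacianMonomial

variable {d : ℕ}

lemma fderiv_coord_mul (i j : Fin d) (p q : ℕ) (y v : EuclideanSpace ℝ (Fin d)) :
    fderiv ℝ (fun z : EuclideanSpace ℝ (Fin d) => z i ^ p * z j ^ q) y v =
      p * v i * (y i ^ (p - 1) * y j ^ q) + q * v j * (y i ^ p * y j ^ (q - 1)) := by
  have h : ∀ l : Fin d, HasFDerivAt (fun z : EuclideanSpace ℝ (Fin d) => z l)
      (EuclideanSpace.proj l : EuclideanSpace ℝ (Fin d) →L[ℝ] ℝ) y := fun l =>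
    (EuclideanSpace.proj l : EuclideanSpace ℝ (Fin d) →L[ℝ] ℝ).hasFDerivAt
  have e : fderiv ℝ (fun z : EuclideanSpace ℝ (Fin d) => z i ^ p * z j ^ q) y = _ :=
    (((h i).pow p).mul ((h j).pow q)).fderiv
  rw [e]
  simp
  ring

lemma lapl_coord_mul {i j : Fin d} (hij : i ≠ j) (p q : ℕ) (y : EuclideanSpace ℝ (Fin d)) :
    lapl d (fun z : EuclideanSpace ℝ (Fin d) => z i ^ p * z j ^ q) y =
      p * (p - 1 : ℕ) * (y i ^ (p - 2) * y j ^ q) +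
        q * (q - 1 : ℕ) * (y i ^ p * y j ^ (q - 2)) := by
  have hd : ∀ (p q : ℕ), DifferentiableAt ℝ
      (fun z : EuclideanSpace ℝ (Fin d) => z i ^ p * z j ^ q) y := fun p q => by fun_prop
  have key : ∀ l : Fin d, fderiv ℝ (fun y => fderiv ℝ
      (fun z : EuclideanSpace ℝ (Fin d) => z i ^ p * z j ^ q) y (EuclideanSpace.single l 1)) y
        (EuclideanSpace.single l 1) =
      (if i = l then p * (p - 1 : ℕ) * (y i ^ (p - 2) * y j ^ q) else 0) +
        if j = l then q * (q - 1 : ℕ) * (y i ^ p * y j ^ (q - 2)) else 0 := by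
    intro l
    simp_rw [fderiv_coord_mul]
    rw [fderiv_fun_add ((hd _ _).const_mul _) ((hd _ _).const_mul _),
      fderiv_const_mul (hd _ _), fderiv_const_mul (hd _ _)]
    simp only [add_apply, smul_apply, fderiv_coord_mul,
      PiLp.single_apply, smul_eq_mul, Nat.sub_sub]
    by_cases hi : i = l
    · have hj : j ≠ l := fun h => hij (hi.trans h.symm)
      simp [hi, hj]
      ring
    · by_cases hj : j = l
      · simp [hi, hj]
        ring
      · simp [hi, hj]
  unfold lapl
  simp_rw [key]
  simp [Finset.sum_add_distrib]

variable {f g : EuclideanSpace ℝ (Fin d) → ℝ} {y : EuclideanSpace ℝ (Fin d)}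

lemma lapl_add_of_contDiffAt (hf : ContDiffAt ℝ 2 f y) (hg : ContDiffAt ℝ 2 g y) :
    lapl d (fun z => f z + g z) y = lapl d f y + lapl d g y := by
  unfold lapl
  rw [← Finset.sum_add_distrib]
  refine Finset.sum_congr rfl fun i _ => ?_
  have hd : ∀ {f : EuclideanSpace ℝ (Fin d) → ℝ}, ContDiffAt ℝ 2 f y →
      DifferentiableAt ℝ (fun z => fderiv ℝ f z (EuclideanSpace.single i 1)) y := fun hf =>
    ((hf.fderiv_right (m := 1) (by norm_num)).differentiableAt (by norm_num)).clm_apply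
      (differentiableAt_const _)
  have : (fun z => fderiv ℝ (fun z => f z + g z) z (EuclideanSpace.single i 1)) =ᶠ[nhds y]
      fun z => fderiv ℝ f z (EuclideanSpace.single i 1) +
        fderiv ℝ g z (EuclideanSpace.single i 1) := by
    filter_upwards [hf.eventually (by simp), hg.eventually (by simp)] with z h1 h2
    rw [fderiv_fun_add (h1.differentiableAt (by norm_num)) (h2.differentiableAt (by norm_num))]
    rfl
  rw [this.fderiv_eq, fderiv_fun_add (hd hf) (hd hg)]
  rfl

lemma lapl_add (hf : ContDiff ℝ 2 f) (hg : ContDiff ℝ 2 g) :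
    lapl d (fun z => f z + g z) y = lapl d f y + lapl d g y :=
  lapl_add_of_contDiffAt hf.contDiffAt hg.contDiffAt

lemma lapl_sub_const (a : ℝ) : lapl d (fun z => f z - a) y = lapl d f y := by
  simp only [lapl, fderiv_sub_const]

lemma lapl_const_mul (hf : ContDiff ℝ 2 f) (a : ℝ) :
    lapl d (fun z => a * f z) y = a * lapl d f y := by
  unfold lapl
  rw [Finset.mul_sum]
  refine Finset.sum_congr rfl fun i _ => ?_
  have h1 := fun z => (hf.differentiable (by norm_num)) z
  have h3 := (hf.contDiff_fderiv_apply_one (EuclideanSpace.single i 1)).differentiable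
    (by norm_num) y
  have : (fun z => fderiv ℝ (fun z => a * f z) z (EuclideanSpace.single i 1)) = fun z =>
      a * fderiv ℝ f z (EuclideanSpace.single i 1) := by
    funext z
    rw [fderiv_const_mul (h1 z)]
    rfl
  rw [this, fderiv_const_mul h3]
  rfl

lemma lapl_sum {ι : Type*} (s : Finset ι) {F : ι → EuclideanSpace ℝ (Fin d) → ℝ}
    (hF : ∀ i, ContDiff ℝ 2 (F i)) :
    lapl d (fun z => ∑ i ∈ s, F i z) y = ∑ i ∈ s, lapl d (F i) y := by
  classical
  induction s using Finset.induction_on with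
  | empty => simp [lapl]
  | insert a s ha ih =>
    simp only [Finset.sum_insert ha]
    rw [lapl_add (hF a) (ContDiff.sum fun i _ => hF i), ih]

end LaplacianMonomial

section Polynomial

variable {k : ℕ}

/-- Coefficients of the pure fourth powers in the obstacle polynomial. -/
def quarticWeight (ε : ℝ) (i : Fin (k + 2)) : ℝ := if i = 0 ∨ i = 1 then ε else 1

/-- The quartic polynomial `x₀²x₁² + ∑ aᵢ xᵢ⁴` on `ℝ^{k+2}`. -/
def thinQuartic (ε : ℝ) (ξ : EuclideanSpace ℝ (Fin (k + 2))) : ℝ :=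
  ξ 0 ^ 2 * ξ 1 ^ 2 + ∑ i, quarticWeight ε i * ξ i ^ 4

/-- The even harmonic extension of `thinQuartic` to `ℝ^{k+3}`. -/
def extQuartic (ε : ℝ) (x : EuclideanSpace ℝ (Fin (k + 3))) : ℝ :=
  x (Fin.castSucc 0) ^ 2 * x (Fin.castSucc 1) ^ 2 +
    (-1) * (x (Fin.castSucc 0) ^ 2 * x (Fin.last _) ^ 2) +
    (-1) * (x (Fin.castSucc 1) ^ 2 * x (Fin.last _) ^ 2) +
    (1 / 3) * (x (Fin.castSucc 0) ^ 0 * x (Fin.last _) ^ 4) +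
    ∑ i : Fin (k + 2), quarticWeight ε i * (x i.castSucc ^ 4 * x (Fin.last _) ^ 0 +
      (-6) * (x i.castSucc ^ 2 * x (Fin.last _) ^ 2) + x i.castSucc ^ 0 * x (Fin.last _) ^ 4)

lemma contDiff_coord_mul {d : ℕ} (i j : Fin d) (p q : ℕ) {r : WithTop ℕ∞} :
    ContDiff ℝ r (fun z : EuclideanSpace ℝ (Fin d) => z i ^ p * z j ^ q) := by
  have h : ∀ l : Fin d, ContDiff ℝ r (fun z : EuclideanSpace ℝ (Fin d) => z l) := fun l =>
    (EuclideanSpace.proj l : EuclideanSpace ℝ (Fin d) →L[ℝ] ℝ).contDiff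
  exact ((h i).pow p).mul ((h j).pow q)

lemma contDiff_extQuartic (ε : ℝ) : ContDiff ℝ 2 (extQuartic (k := k) ε) := by
  have h := fun i j p q => contDiff_coord_mul (d := k + 3) i j p q (r := 2)
  refine ContDiff.add (ContDiff.add (ContDiff.add (ContDiff.add (h _ _ _ _)
    (contDiff_const.mul (h _ _ _ _))) (contDiff_const.mul (h _ _ _ _)))
    (contDiff_const.mul (h _ _ _ _))) (ContDiff.sum fun i _ => contDiff_const.mul ?_)
  exact ((h _ _ _ _).add (contDiff_const.mul (h _ _ _ _))).add (h _ _ _ _)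

lemma lapl_extQuartic (ε : ℝ) (x : EuclideanSpace ℝ (Fin (k + 3))) :
    lapl (k + 3) (extQuartic ε) x = 0 := by
  have h := fun i j p q => contDiff_coord_mul (d := k + 3) i j p q (r := 2)
  have hc := fun (a : ℝ) i j p q => contDiff_const (c := a).mul (h i j p q)
  have hne : ∀ i : Fin (k + 2), i.castSucc ≠ Fin.last (k + 2) := fun i => (Fin.castSucc_lt_last i).ne
  have h01 : (Fin.castSucc 0 : Fin (k + 3)) ≠ Fin.castSucc 1 := by
    simp
  have hs : ∀ i : Fin (k + 2), ContDiff ℝ 2 (fun x : EuclideanSpace ℝ (Fin (k + 3)) =>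
      x i.castSucc ^ 4 * x (Fin.last _) ^ 0 +
      (-6) * (x i.castSucc ^ 2 * x (Fin.last _) ^ 2) + x i.castSucc ^ 0 * x (Fin.last _) ^ 4) :=
    fun i => ((h _ _ _ _).add (hc _ _ _ _ _)).add (h _ _ _ _)
  unfold extQuartic
  rw [lapl_add ((((h _ _ _ _).add (hc _ _ _ _ _)).add (hc _ _ _ _ _)).add (hc _ _ _ _ _))
      (ContDiff.sum fun i _ => contDiff_const.mul (hs i)),
    lapl_add (((h _ _ _ _).add (hc _ _ _ _ _)).add (hc _ _ _ _ _)) (hc _ _ _ _ _),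
    lapl_add ((h _ _ _ _).add (hc _ _ _ _ _)) (hc _ _ _ _ _),
    lapl_add (h _ _ _ _) (hc _ _ _ _ _),
    lapl_const_mul (h _ _ _ _), lapl_const_mul (h _ _ _ _), lapl_const_mul (h _ _ _ _),
    lapl_coord_mul h01, lapl_coord_mul (hne 0), lapl_coord_mul (hne 1), lapl_coord_mul (hne 0),
    lapl_sum _ (fun i => contDiff_const.mul (hs i))]
  have hz : ∀ i : Fin (k + 2), lapl (k + 3) (fun x : EuclideanSpace ℝ (Fin (k + 3)) =>
      quarticWeight ε i * (x i.castSucc ^ 4 * x (Fin.last _) ^ 0 +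
      (-6) * (x i.castSucc ^ 2 * x (Fin.last _) ^ 2) +
        x i.castSucc ^ 0 * x (Fin.last _) ^ 4)) x = 0 := by
    intro i
    rw [lapl_const_mul (hs i), lapl_add ((h _ _ _ _).add (hc _ _ _ _ _)) (h _ _ _ _),
      lapl_add (h _ _ _ _) (hc _ _ _ _ _), lapl_const_mul (h _ _ _ _),
      lapl_coord_mul (hne i), lapl_coord_mul (hne i), lapl_coord_mul (hne i)]
    norm_num
    ring_nf
    simp
  rw [Finset.sum_eq_zero fun i _ => hz i]
  norm_num
  ring

lemma extQuartic_smul (ε c : ℝ) (x : EuclideanSpace ℝ (Fin (k + 3))) :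
    extQuartic ε (c • x) = c ^ 4 * extQuartic ε x := by
  simp only [extQuartic, PiLp.smul_apply, smul_eq_mul, pow_zero, mul_add, Finset.mul_sum]
  refine congrArg₂ _ (by ring) (Finset.sum_congr rfl fun i _ => by ring)

lemma exists_abs_extQuartic_le (ε : ℝ) :
    ∃ C : ℝ, 0 ≤ C ∧ ∀ x : EuclideanSpace ℝ (Fin (k + 3)), |extQuartic ε x| ≤ C * ‖x‖ ^ 4 := by
  obtain ⟨C, hC⟩ := (isCompact_closedBall (0 : EuclideanSpace ℝ (Fin (k + 3))) 1
    ).exists_bound_of_continuousOn (contDiff_extQuartic ε).continuous.continuousOn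
  have hC0 : 0 ≤ C := (norm_nonneg _).trans (hC 0 (by simp))
  refine ⟨C, hC0, fun x => ?_⟩
  rcases eq_or_ne x 0 with rfl | hx
  · have := extQuartic_smul ε 0 (0 : EuclideanSpace ℝ (Fin (k + 3)))
    rw [smul_zero] at this
    rw [this]
    norm_num
  have hn : ‖x‖ ≠ 0 := norm_ne_zero_iff.2 hx
  have h1 : x = ‖x‖ • (‖x‖⁻¹ • x) := by rw [smul_smul, mul_inv_cancel₀ hn, one_smul]
  have h2 := hC (‖x‖⁻¹ • x) (by simp [norm_smul, hn])
  rw [Real.norm_eq_abs] at h2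
  rw [h1, extQuartic_smul, abs_mul, ← h1, abs_of_nonneg (by positivity), mul_comm]
  gcongr

lemma extQuartic_congr_abs {ε : ℝ} {x y : EuclideanSpace ℝ (Fin (k + 3))}
    (h : ∀ i, |x i| = |y i|) : extQuartic ε x = extQuartic ε y := by
  have h2 : ∀ i, x i ^ 2 = y i ^ 2 := fun i => sq_eq_sq_iff_abs_eq_abs _ _ |>.2 (h i)
  have h4 : ∀ i, x i ^ 4 = y i ^ 4 := fun i => by
    rw [show 4 = 2 * 2 by rfl, pow_mul, pow_mul, h2]
  simp only [extQuartic, h2, h4, pow_zero]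

lemma extQuartic_swap (ε : ℝ) (x : EuclideanSpace ℝ (Fin (k + 3))) :
    extQuartic ε (LinearIsometryEquiv.piLpCongrLeft 2 ℝ ℝ
      (Equiv.swap (Fin.castSucc 0 : Fin (k + 3)) (Fin.castSucc 1)) x) = extQuartic ε x := by
  set τ := Equiv.swap (Fin.castSucc 0 : Fin (k + 3)) (Fin.castSucc 1) with hτ
  have hx : ∀ i, LinearIsometryEquiv.piLpCongrLeft 2 ℝ ℝ τ x i = x (τ i) := fun i => by
    simp [hτ, LinearIsometryEquiv.piLpCongrLeft_apply, Equiv.piCongrLeft']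
  have hl : τ (Fin.last _) = Fin.last _ :=
    Equiv.swap_apply_of_ne_of_ne (Fin.castSucc_lt_last _).ne' (Fin.castSucc_lt_last _).ne'
  have hc : ∀ i : Fin (k + 2), τ i.castSucc = (Equiv.swap 0 1 i).castSucc := fun i => by
    rw [hτ, ← Function.Injective.map_swap (Fin.castSucc_injective _)]
  have hw : ∀ i : Fin (k + 2), quarticWeight ε (Equiv.swap 0 1 i) = quarticWeight ε i := fun i => by
    by_cases h0 : i = 0
    · simp [h0, quarticWeight]
    by_cases h1 : i = 1
    · simp [h1, quarticWeight]
    rw [Equiv.swap_apply_of_ne_of_ne h0 h1]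
  simp only [extQuartic, hx, hl, hc]
  have hsum := Equiv.sum_comp (Equiv.swap (0 : Fin (k + 2)) 1) fun i : Fin (k + 2) =>
    quarticWeight ε i * (x i.castSucc ^ 4 * x (Fin.last _) ^ 0 +
      (-6) * (x i.castSucc ^ 2 * x (Fin.last _) ^ 2) + x i.castSucc ^ 0 * x (Fin.last _) ^ 4)
  simp only [hw] at hsum
  rw [hsum, Equiv.swap_apply_left, Equiv.swap_apply_right]
  ring

lemma extQuartic_thin (ε : ℝ) {x : EuclideanSpace ℝ (Fin (k + 3))} (hx : x (Fin.last _) = 0) :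
    extQuartic ε x = thinQuartic ε (thinProj (k + 2) x) := by
  simp [extQuartic, thinQuartic, thinProj, hx]

lemma continuous_thinQuartic (ε : ℝ) : Continuous (thinQuartic (k := k) ε) := by
  unfold thinQuartic
  fun_prop

lemma norm_pow_four_le_sum {d : ℕ} (ξ : EuclideanSpace ℝ (Fin d)) :
    ‖ξ‖ ^ 4 ≤ d * ∑ i, ξ i ^ 4 := by
  have h := sq_sum_le_card_mul_sum_sq (s := Finset.univ) (f := fun i => ξ i ^ 2)
  rw [show 4 = 2 * 2 by rfl, pow_mul, EuclideanSpace.norm_sq_eq]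
  simp only [← pow_mul, Finset.card_univ, Fintype.card_fin, Real.norm_eq_abs, sq_abs] at h ⊢
  exact h

lemma le_quarticWeight {ε : ℝ} (hε : ε ≤ 1) (i : Fin (k + 2)) : ε ≤ quarticWeight ε i := by
  unfold quarticWeight
  split_ifs <;> linarith

lemma le_thinQuartic {ε : ℝ} (hε0 : 0 < ε) (hε : ε ≤ 1) (ξ : EuclideanSpace ℝ (Fin (k + 2))) :
    ε / (k + 2) * ‖ξ‖ ^ 4 ≤ thinQuartic ε ξ := by
  have h1 : ε * ∑ i, ξ i ^ 4 ≤ ∑ i, quarticWeight ε i * ξ i ^ 4 := by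
    rw [Finset.mul_sum]
    exact Finset.sum_le_sum fun i _ =>
      mul_le_mul_of_nonneg_right (le_quarticWeight hε i) (by positivity)
  have h2 := norm_pow_four_le_sum ξ
  push_cast at h2
  have h3 : ε / (k + 2) * ‖ξ‖ ^ 4 ≤ ε * ∑ i, ξ i ^ 4 := by
    rw [div_mul_eq_mul_div, div_le_iff₀ (by positivity)]
    nlinarith [mul_le_mul_of_nonneg_left h2 hε0.le]
  have h4 : 0 ≤ ξ 0 ^ 2 * ξ 1 ^ 2 := by positivity
  unfold thinQuartic
  linarith

lemma tendsto_thinQuartic {ε : ℝ} (hε0 : 0 < ε) (hε : ε ≤ 1) :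
    Tendsto (thinQuartic (k := k) ε) (cocompact (EuclideanSpace ℝ (Fin (k + 2)))) atTop := by
  refine tendsto_atTop_mono (le_thinQuartic hε0 hε) ?_
  refine Tendsto.const_mul_atTop (by positivity) ?_
  exact (tendsto_pow_atTop (by norm_num)).comp tendsto_norm_cocompact_atTop

end Polynomial

section ThinEquilibrium

variable {n : ℕ}

lemma thinEmbed_castSucc (ξ : EuclideanSpace ℝ (Fin n)) (t : ℝ) (i : Fin n) :
    thinEmbed n ξ t i.castSucc = ξ i := by
  simp [thinEmbed, EuclideanSpace.equiv]

lemma thinEmbed_last (ξ : EuclideanSpace ℝ (Fin n)) (t : ℝ) :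
    thinEmbed n ξ t (Fin.last n) = t := by
  simp [thinEmbed, EuclideanSpace.equiv]

lemma thinProj_apply (x : EuclideanSpace ℝ (Fin (n + 1))) (i : Fin n) :
    thinProj n x i = x i.castSucc := by
  simp [thinProj, EuclideanSpace.equiv]

lemma thinProj_thinEmbed (ξ : EuclideanSpace ℝ (Fin n)) (t : ℝ) :
    thinProj n (thinEmbed n ξ t) = ξ := by
  ext i
  rw [thinProj_apply, thinEmbed_castSucc]

lemma thinEmbed_thinProj {x : EuclideanSpace ℝ (Fin (n + 1))} (hx : x (Fin.last n) = 0) :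
    thinEmbed n (thinProj n x) 0 = x := by
  ext i
  refine Fin.lastCases ?_ (fun i => ?_) i
  · rw [thinEmbed_last, hx]
  · rw [thinEmbed_castSucc, thinProj_apply]

lemma isometry_thinEmbed : Isometry fun ξ : EuclideanSpace ℝ (Fin n) => thinEmbed n ξ 0 := by
  refine Isometry.of_dist_eq fun ξ η => ?_
  simp [EuclideanSpace.dist_eq, Fin.sum_univ_castSucc, thinEmbed_castSucc, thinEmbed_last]

lemma norm_thinProj {x : EuclideanSpace ℝ (Fin (n + 1))} (hx : x (Fin.last n) = 0) :
    ‖thinProj n x‖ = ‖x‖ := by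
  simp [EuclideanSpace.norm_eq, Fin.sum_univ_castSucc, thinProj_apply, hx]

lemma pot_map_thinEmbed (m : ℕ) (M : Measure (EuclideanSpace ℝ (Fin n)))
    (ξ : EuclideanSpace ℝ (Fin n)) :
    pot m (M.map fun η => thinEmbed n η 0) (thinEmbed n ξ 0) = pot m M ξ := by
  have hi := isometry_thinEmbed (n := n)
  unfold pot
  rw [lintegral_map (measurable_kern_right _ _) hi.continuous.measurable]
  simp only [kern, hi.edist_eq]

variable {k : ℕ}

/-- `M` is an equilibrium measure, carried by the compact subset `S` of the thin space, for the
kernel `|x - y|^{-(k + 1)}` in the external field `extQuartic ε`, with constant `c`. -/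
structure IsThinEquilibrium (ε : ℝ) (M : Measure (EuclideanSpace ℝ (Fin (k + 3))))
    (S : Set (EuclideanSpace ℝ (Fin (k + 3)))) (c : ℝ) : Prop where
  isProbabilityMeasure : IsProbabilityMeasure M
  isCompact : IsCompact S
  ae_mem : ∀ᵐ y ∂M, y ∈ S
  last_eq_zero : ∀ x ∈ S, x (Fin.last _) = 0
  const_nonneg : 0 ≤ c
  le_pot_add : ∀ x, x (Fin.last _) = 0 →
    ENNReal.ofReal c ≤ pot (k + 1) M x + ENNReal.ofReal (extQuartic ε x)
  pot_add_eq : ∀ x ∈ S, pot (k + 1) M x + ENNReal.ofReal (extQuartic ε x) = ENNReal.ofReal c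

lemma exists_isThinEquilibrium {ε : ℝ} (hε0 : 0 < ε) (hε : ε ≤ 1) :
    ∃ M S c, IsThinEquilibrium (k := k) ε M S c := by
  obtain ⟨M, S, c, hM, hS, hMS, hc, hle, heq⟩ := exists_equilibrium (m := k + 1)
    (Nat.succ_ne_zero k) (continuous_thinQuartic (k := k) ε) (tendsto_thinQuartic hε0 hε)
  have hi := isometry_thinEmbed (n := k + 2)
  have hme : Measurable fun ξ : EuclideanSpace ℝ (Fin (k + 2)) => thinEmbed (k + 2) ξ 0 :=
    hi.continuous.measurable
  have hq : ∀ ξ, extQuartic ε (thinEmbed (k + 2) ξ 0) = thinQuartic ε ξ := fun ξ => by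
    rw [extQuartic_thin ε (thinEmbed_last _ _), thinProj_thinEmbed]
  have hSc := hS.image hi.continuous
  refine ⟨M.map fun ξ => thinEmbed (k + 2) ξ 0, (fun ξ => thinEmbed (k + 2) ξ 0) '' S, c,
    Measure.isProbabilityMeasure_map hme.aemeasurable, hSc, ?_, ?_, hc, ?_, ?_⟩
  · refine (ae_map_iff (p := fun y => y ∈ (fun ξ => thinEmbed (k + 2) ξ 0) '' S)
      hme.aemeasurable hSc.isClosed.measurableSet).2 ?_
    filter_upwards [show ∀ᵐ y ∂M, y ∈ S from hMS] with y hy using mem_image_of_mem _ hy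
  · rintro _ ⟨ξ, -, rfl⟩
    exact thinEmbed_last _ _
  · intro x hx
    rw [← thinEmbed_thinProj hx, pot_map_thinEmbed, hq]
    exact hle _
  · rintro _ ⟨ξ, hξ, rfl⟩
    simp only [pot_map_thinEmbed, hq]
    exact heq ξ hξ

end ThinEquilibrium

section QuarticSolution

variable {k : ℕ} {ε : ℝ} {M : Measure (EuclideanSpace ℝ (Fin (k + 3)))}
  {S : Set (EuclideanSpace ℝ (Fin (k + 3)))} {c : ℝ}

lemma zero_le_extQuartic_thin (hε : 0 ≤ ε) {x : EuclideanSpace ℝ (Fin (k + 3))}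
    (hx : x (Fin.last _) = 0) : 0 ≤ extQuartic ε x := by
  rw [extQuartic_thin ε hx, thinQuartic]
  refine add_nonneg (by positivity) (Finset.sum_nonneg fun i _ => ?_)
  have : 0 ≤ quarticWeight ε i := by
    unfold quarticWeight
    split_ifs <;> positivity
  positivity

/-- The candidate solution: the potential of `M` plus the quartic field, minus a constant. -/
def quarticSolution (ε : ℝ) (M : Measure (EuclideanSpace ℝ (Fin (k + 3)))) (c : ℝ)
    (x : EuclideanSpace ℝ (Fin (k + 3))) : ℝ :=
  (pot (k + 1) M x).toReal + extQuartic ε x - c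

namespace IsThinEquilibrium

lemma pot_ne_top_of_mem (h : IsThinEquilibrium ε M S c) {x : EuclideanSpace ℝ (Fin (k + 3))}
    (hx : x ∈ S) : pot (k + 1) M x ≠ ⊤ := fun ht => by
  have := h.pot_add_eq x hx
  rw [ht, top_add] at this
  exact ENNReal.ofReal_ne_top this.symm

lemma pot_ne_top (h : IsThinEquilibrium ε M S c) (x : EuclideanSpace ℝ (Fin (k + 3))) :
    pot (k + 1) M x ≠ ⊤ :=
  have := h.isProbabilityMeasure
  _root_.pot_ne_top (m := k + 1) h.isCompact h.ae_mem (fun _ hx => h.pot_ne_top_of_mem hx) x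

lemma continuous_pot (h : IsThinEquilibrium ε M S c) : Continuous (pot (k + 1) M) := by
  have := h.isProbabilityMeasure
  refine _root_.continuous_pot (m := k + 1) (Nat.succ_ne_zero k) h.isCompact h.ae_mem ?_
    fun _ hx => h.pot_ne_top_of_mem hx
  have h1 : ContinuousOn (fun x : EuclideanSpace ℝ (Fin (k + 3)) =>
      ENNReal.ofReal c - ENNReal.ofReal (extQuartic ε x)) S :=
    ((ENNReal.continuous_sub_left ENNReal.ofReal_ne_top).comp
      (ENNReal.continuous_ofReal.comp (contDiff_extQuartic ε).continuous)).continuousOn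
  refine h1.congr fun x hx => ?_
  simp only [← h.pot_add_eq x hx, ENNReal.add_sub_cancel_right ENNReal.ofReal_ne_top]

lemma continuous_toReal_pot (h : IsThinEquilibrium ε M S c) :
    Continuous fun x => (pot (k + 1) M x).toReal :=
  continuous_iff_continuousAt.2 fun x =>
    (ENNReal.tendsto_toReal (h.pot_ne_top x)).comp h.continuous_pot.continuousAt

lemma continuous (h : IsThinEquilibrium ε M S c) : Continuous (quarticSolution ε M c) :=
  (h.continuous_toReal_pot.add (contDiff_extQuartic ε).continuous).sub continuous_const

lemma nonneg (h : IsThinEquilibrium ε M S c) (hε : 0 ≤ ε) {x : EuclideanSpace ℝ (Fin (k + 3))}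
    (hx : x (Fin.last _) = 0) : 0 ≤ quarticSolution ε M c x := by
  have h1 := ENNReal.toReal_mono (ENNReal.add_ne_top.2 ⟨h.pot_ne_top x, ENNReal.ofReal_ne_top⟩)
    (h.le_pot_add x hx)
  rw [ENNReal.toReal_add (h.pot_ne_top x) ENNReal.ofReal_ne_top,
    ENNReal.toReal_ofReal h.const_nonneg,
    ENNReal.toReal_ofReal (zero_le_extQuartic_thin hε hx)] at h1
  unfold quarticSolution
  linarith

lemma eq_zero (h : IsThinEquilibrium ε M S c) (hε : 0 ≤ ε) {x : EuclideanSpace ℝ (Fin (k + 3))}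
    (hx : x ∈ S) : quarticSolution ε M c x = 0 := by
  have h1 := congrArg ENNReal.toReal (h.pot_add_eq x hx)
  rw [ENNReal.toReal_add (h.pot_ne_top x) ENNReal.ofReal_ne_top,
    ENNReal.toReal_ofReal h.const_nonneg,
    ENNReal.toReal_ofReal (zero_le_extQuartic_thin hε (h.last_eq_zero x hx))] at h1
  unfold quarticSolution
  linarith

lemma mem_contactSet_of_mem (h : IsThinEquilibrium ε M S c) (hε : 0 ≤ ε)
    {x : EuclideanSpace ℝ (Fin (k + 3))} (hx : x ∈ S) :
    x ∈ contactSet (k + 2) (fun _ => 0) (quarticSolution ε M c) :=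
  ⟨h.last_eq_zero x hx, h.eq_zero hε hx⟩

lemma isHarmonicOnSet (h : IsThinEquilibrium ε M S c) :
    IsHarmonicOnSet (k + 3) (quarticSolution ε M c) Sᶜ := by
  have := h.isProbabilityMeasure
  obtain ⟨h1, h2⟩ := pot_toReal_harmonic (m := k + 1) h.isCompact h.ae_mem
  refine ⟨(h1.add (contDiff_extQuartic ε).contDiffOn).sub contDiffOn_const, fun x hx => ?_⟩
  have h3 := h1.contDiffAt (h.isCompact.isClosed.isOpen_compl.mem_nhds hx)
  unfold quarticSolution
  rw [lapl_sub_const, lapl_add_of_contDiffAt h3 (contDiff_extQuartic ε).contDiffAt, h2 x hx,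
    lapl_extQuartic, add_zero]

lemma even (h : IsThinEquilibrium ε M S c) (ξ : EuclideanSpace ℝ (Fin (k + 2))) (t : ℝ) :
    quarticSolution ε M c (thinEmbed (k + 2) ξ t) =
      quarticSolution ε M c (thinEmbed (k + 2) ξ (-t)) := by
  have h1 : pot (k + 1) M (thinEmbed (k + 2) ξ t) = pot (k + 1) M (thinEmbed (k + 2) ξ (-t)) := by
    refine lintegral_congr_ae ?_
    filter_upwards [h.ae_mem] with y hy
    have hd : dist (thinEmbed (k + 2) ξ t) y = dist (thinEmbed (k + 2) ξ (-t)) y := by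
      simp [EuclideanSpace.dist_eq, Fin.sum_univ_castSucc, thinEmbed_castSucc, thinEmbed_last,
        h.last_eq_zero y hy, Real.dist_eq]
    simp only [kern, edist_dist, hd]
  have h2 : extQuartic ε (thinEmbed (k + 2) ξ t) = extQuartic ε (thinEmbed (k + 2) ξ (-t)) := by
    refine extQuartic_congr_abs fun i => ?_
    refine Fin.lastCases ?_ (fun i => ?_) i
    · rw [thinEmbed_last, thinEmbed_last, abs_neg]
    · rw [thinEmbed_castSucc, thinEmbed_castSucc]
  rw [quarticSolution, quarticSolution, h1, h2]

lemma superMeanVal (h : IsThinEquilibrium ε M S c) :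
    SuperMeanVal (k + 3) (quarticSolution ε M c) := by
  have := h.isProbabilityMeasure
  intro x r hr
  have hvol : 0 < volume.real (ball x r) :=
    ENNReal.toReal_pos (measure_ball_pos _ _ hr).ne' measure_ball_lt_top.ne
  have hintg : ∀ {f : EuclideanSpace ℝ (Fin (k + 3)) → ℝ}, Continuous f →
      IntegrableOn f (ball x r) := fun hf =>
    (hf.continuousOn.integrableOn_compact (isCompact_closedBall _ _)).mono_set
      ball_subset_closedBall
  have hp := h.continuous_toReal_pot
  have hq := (contDiff_extQuartic (k := k) ε).continuous
  have h1 : ∫ y in ball x r, (pot (k + 1) M y).toReal ≤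
      volume.real (ball x r) * (pot (k + 1) M x).toReal := by
    rw [integral_toReal h.continuous_pot.measurable.aemeasurable
      (Eventually.of_forall fun y => (h.pot_ne_top y).lt_top), measureReal_def,
      ← ENNReal.toReal_mul]
    exact ENNReal.toReal_mono (ENNReal.mul_ne_top measure_ball_lt_top.ne (h.pot_ne_top x))
      (lintegral_ball_pot_le (m := k + 1) (Nat.succ_ne_zero k) x hr)
  have h2 : ∫ y in ball x r, extQuartic ε y = volume.real (ball x r) * extQuartic ε x :=
    setIntegral_ball_eq (Nat.succ_pos _) isOpen_univ (contDiff_extQuartic ε).contDiffOn x hr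
      (subset_univ _) fun y _ => lapl_extQuartic ε y
  have h3 : ∫ y in ball x r, quarticSolution ε M c y =
      (∫ y in ball x r, (pot (k + 1) M y).toReal) + (∫ y in ball x r, extQuartic ε y) -
        volume.real (ball x r) * c := by
    have hpq : IntegrableOn (fun y => (pot (k + 1) M y).toReal + extQuartic ε y) (ball x r) :=
      hintg (hp.add hq)
    unfold quarticSolution
    rw [integral_sub hpq (hintg continuous_const), integral_add (hintg hp) (hintg hq),
      setIntegral_const, smul_eq_mul]
  rw [setAverage_eq, smul_eq_mul, inv_mul_le_iff₀ hvol, h3, h2]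
  unfold quarticSolution
  linarith

lemma isGlobalSolution (h : IsThinEquilibrium ε M S c) (hε : 0 ≤ ε) :
    IsGlobalSolution (k + 2) (fun _ => 0) (quarticSolution ε M c) := by
  refine ⟨h.continuous, h.even, fun ξ => h.nonneg hε (thinEmbed_last _ _), ?_, h.superMeanVal⟩
  have hsub : (contactSet (k + 2) (fun _ => 0) (quarticSolution ε M c))ᶜ ⊆ Sᶜ :=
    compl_subset_compl.2 fun x hx => h.mem_contactSet_of_mem hε hx
  exact ⟨h.isHarmonicOnSet.1.mono hsub, fun x hx => h.isHarmonicOnSet.2 x (hsub hx)⟩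

end IsThinEquilibrium

end QuarticSolution

section QuarticSolutionContact

variable {k : ℕ} {ε : ℝ} {M : Measure (EuclideanSpace ℝ (Fin (k + 3)))}
  {S : Set (EuclideanSpace ℝ (Fin (k + 3)))} {c : ℝ}

lemma norm_pow_four_le_extQuartic (hε0 : 0 < ε) (hε : ε ≤ 1)
    {x : EuclideanSpace ℝ (Fin (k + 3))} (hx : x (Fin.last _) = 0) :
    ε / (k + 2) * ‖x‖ ^ 4 ≤ extQuartic ε x := by
  rw [extQuartic_thin ε hx, ← norm_thinProj hx]
  exact le_thinQuartic hε0 hε _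

lemma norm_pow_four_sub_le_quarticSolution (hε0 : 0 < ε) (hε : ε ≤ 1)
    {x : EuclideanSpace ℝ (Fin (k + 3))} (hx : x (Fin.last _) = 0) :
    ε / (k + 2) * ‖x‖ ^ 4 - c ≤ quarticSolution ε M c x := by
  have h1 := norm_pow_four_le_extQuartic hε0 hε hx
  have h2 : 0 ≤ (pot (k + 1) M x).toReal := ENNReal.toReal_nonneg
  unfold quarticSolution
  linarith

lemma extQuartic_le_of_mem_contactSet {x : EuclideanSpace ℝ (Fin (k + 3))}
    (hx : x ∈ contactSet (k + 2) (fun _ => 0) (quarticSolution ε M c)) : extQuartic ε x ≤ c := by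
  have h1 := hx.2
  have h2 : 0 ≤ (pot (k + 1) M x).toReal := ENNReal.toReal_nonneg
  unfold quarticSolution at h1
  linarith

namespace IsThinEquilibrium

lemma tendsto_toReal_pot (h : IsThinEquilibrium ε M S c) :
    Tendsto (fun x => (pot (k + 1) M x).toReal)
      (cocompact (EuclideanSpace ℝ (Fin (k + 3)))) (nhds 0) := by
  have := h.isProbabilityMeasure
  obtain ⟨ρ, hρ⟩ := h.isCompact.isBounded.exists_norm_le
  have hM : ∀ᵐ y ∂M, ‖y‖ ≤ ρ := h.ae_mem.mono hρ
  have hn : Tendsto (fun x : EuclideanSpace ℝ (Fin (k + 3)) => ‖x‖ - ρ) (cocompact _) atTop :=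
    tendsto_atTop_add_const_right _ _ tendsto_norm_cocompact_atTop
  have hlim : Tendsto (fun x : EuclideanSpace ℝ (Fin (k + 3)) => (‖x‖ - ρ)⁻¹ ^ (k + 1))
      (cocompact _) (nhds 0) := by
    simpa using (tendsto_inv_atTop_zero.comp hn).pow (k + 1)
  refine squeeze_zero' (Eventually.of_forall fun x => ENNReal.toReal_nonneg) ?_ hlim
  filter_upwards [hn.eventually_gt_atTop 0] with x hx
  have h1 := pot_le_of_norm_lt (m := k + 1) hM (x := x) (by linarith)
  exact ENNReal.toReal_le_of_le_ofReal (by positivity) h1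

lemma exists_toReal_pot_le (h : IsThinEquilibrium ε M S c) :
    ∃ B : ℝ, 0 ≤ B ∧ ∀ x, (pot (k + 1) M x).toReal ≤ B := by
  obtain ⟨K, hK, hKB⟩ := mem_cocompact.1
    (h.tendsto_toReal_pot.eventually (gt_mem_nhds (zero_lt_one' ℝ)))
  obtain ⟨C, hC⟩ := hK.exists_bound_of_continuousOn h.continuous_toReal_pot.continuousOn
  refine ⟨max C 1, by positivity, fun x => ?_⟩
  by_cases hx : x ∈ K
  · exact ((le_abs_self _).trans (hC x hx)).trans (le_max_left _ _)
  · exact (hKB hx).le.trans (le_max_right _ _)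

lemma polyGrowthOrder (h : IsThinEquilibrium ε M S c) (hε0 : 0 < ε) (hε : ε ≤ 1) :
    PolyGrowthOrder (k + 3) (quarticSolution ε M c) 4 := by
  constructor
  · obtain ⟨B, hB0, hB⟩ := h.exists_toReal_pot_le
    obtain ⟨C, hC0, hC⟩ := exists_abs_extQuartic_le (k := k) ε
    refine ⟨B + C + c, fun x => ?_⟩
    have h1 := abs_le.1 (hC x)
    have h2 := hB x
    have h3 : 0 ≤ (pot (k + 1) M x).toReal := ENNReal.toReal_nonneg
    have h4 : 0 ≤ ‖x‖ ^ 4 := by positivity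
    have h5 := h.const_nonneg
    unfold quarticSolution
    rw [abs_le]
    constructor <;> nlinarith [mul_nonneg hB0 h4, mul_nonneg h5 h4]
  · rintro m ⟨C, hC⟩
    by_contra! hm
    set a : ℝ := ε / (k + 2) with ha
    have ha0 : 0 < a := by positivity
    have hc := h.const_nonneg
    set s : ℝ := 1 + (2 * |C| + c) / a with hs
    have hs1 : 1 ≤ s := by
      rw [hs]
      have : 0 ≤ (2 * |C| + c) / a := by positivity
      linarith
    have hs2 : a * s = a + (2 * |C| + c) := by
      rw [hs]
      field_simp
    set x : EuclideanSpace ℝ (Fin (k + 3)) := EuclideanSpace.single (Fin.castSucc 0) s with hx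
    have hxl : x (Fin.last _) = 0 := by simp [hx]
    have hxn : ‖x‖ = s := by
      rw [hx, PiLp.norm_single, Real.norm_of_nonneg (by linarith)]
    have h1 := norm_pow_four_sub_le_quarticSolution (M := M) (c := c) hε0 hε hxl
    have h2 := (le_abs_self _).trans (hC x)
    rw [hxn] at h1 h2
    have h3 : s ^ m ≤ s ^ 3 := pow_le_pow_right₀ hs1 (by omega)
    have h4 : 1 ≤ s ^ 3 := one_le_pow₀ hs1
    have h5 : C * (1 + s ^ m) ≤ |C| * (2 * s ^ 3) :=
      mul_le_mul (le_abs_self C) (by linarith) (by positivity) (abs_nonneg C)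
    have h6 : a * s ^ 4 = (a + (2 * |C| + c)) * s ^ 3 := by
      rw [← hs2]
      ring
    nlinarith [mul_le_mul_of_nonneg_left h4 hc]

lemma isCompact_contactSet (h : IsThinEquilibrium ε M S c) (hε0 : 0 < ε) (hε : ε ≤ 1) :
    IsCompact (contactSet (k + 2) (fun _ => 0) (quarticSolution ε M c)) := by
  refine isCompact_of_isClosed_isBounded ?_ ?_
  · exact (isClosed_eq (by fun_prop) continuous_const).inter
      (isClosed_eq h.continuous continuous_const)
  · refine isBounded_iff_forall_norm_le.2 ⟨1 + c / (ε / (k + 2)), fun x hx => ?_⟩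
    have h1 := (norm_pow_four_le_extQuartic hε0 hε hx.1).trans
      (extQuartic_le_of_mem_contactSet hx)
    have ha0 : 0 < ε / ((k : ℝ) + 2) := by positivity
    rw [mul_comm, ← le_div_iff₀ ha0] at h1
    rcases le_total ‖x‖ 1 with h2 | h2
    · have := div_nonneg h.const_nonneg ha0.le
      linarith
    · have := le_self_pow₀ h2 (by norm_num : 4 ≠ 0)
      linarith

lemma smul_map_mem_contactSet (h : IsThinEquilibrium ε M S c) (hε : 0 ≤ ε)
    (σ : EuclideanSpace ℝ (Fin (k + 3)) ≃ₗᵢ[ℝ] EuclideanSpace ℝ (Fin (k + 3)))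
    (hl : ∀ x, σ x (Fin.last _) = x (Fin.last _)) (hq : ∀ x, extQuartic ε (σ x) = extQuartic ε x)
    {t : ℝ} (ht0 : 0 < t) (ht : t ≤ 1) {x : EuclideanSpace ℝ (Fin (k + 3))}
    (hx : x ∈ contactSet (k + 2) (fun _ => 0) (quarticSolution ε M c)) :
    t • σ x ∈ contactSet (k + 2) (fun _ => 0) (quarticSolution ε M c) := by
  have hthin : ∀ y : EuclideanSpace ℝ (Fin (k + 3)),
      (t • σ y) (Fin.last _) = t * y (Fin.last _) := fun y => by
    rw [PiLp.smul_apply, hl, smul_eq_mul]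
  have htinv : 1 ≤ t⁻¹ ^ 4 := one_le_pow₀ ((one_le_inv₀ ht0).2 ht)
  have hcomp : Continuous fun y => t • σ y := σ.continuous.const_smul t
  have hle := le_of_superMeanVal (Nat.succ_pos _) h.continuous
    (w := fun y => t⁻¹ ^ 4 * quarticSolution ε M c (t • σ y))
    (continuous_const.mul (h.continuous.comp hcomp)) h.superMeanVal
    (Z := {y | t • σ y ∈ contactSet (k + 2) (fun _ => 0) (quarticSolution ε M c)}) ?_ ?_ ?_ x
  · have h1 : (t • σ x) (Fin.last _) = 0 := by rw [hthin, hx.1, mul_zero]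
    refine ⟨h1, le_antisymm ?_ (h.nonneg hε h1)⟩
    rw [hx.2] at hle
    exact nonpos_of_mul_nonpos_right hle (by positivity)
  · intro y hy
    have h1 : y (Fin.last _) = 0 := by
      have := hy.1
      rw [hthin] at this
      exact (mul_eq_zero.1 this).resolve_left ht0.ne'
    simp only [hy.2, mul_zero]
    exact h.nonneg hε h1
  · intro y hy
    have hyS : t • σ y ∈ Sᶜ := fun hS => hy (h.mem_contactSet_of_mem hε hS)
    obtain ⟨R, hR, hRS⟩ := Metric.nhds_basis_closedBall.mem_iff.1
      (h.isCompact.isClosed.isOpen_compl.mem_nhds hyS)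
    refine ⟨t⁻¹ * R, by positivity, le_of_eq ?_⟩
    have h1 : ⨍ z in ball (t • σ y) R, quarticSolution ε M c z =
        quarticSolution ε M c (t • σ y) := by
      rw [setAverage_eq, setIntegral_ball_eq (Nat.succ_pos _) h.isCompact.isClosed.isOpen_compl
        h.isHarmonicOnSet.1 _ hR hRS fun z hz => h.isHarmonicOnSet.2 z
          (hRS (ball_subset_closedBall hz)), smul_eq_mul, inv_mul_cancel_left₀]
      exact (ENNReal.toReal_pos (measure_ball_pos _ _ hR).ne' measure_ball_lt_top.ne).ne'
    have h2 := setAverage_comp_similarity (f := quarticSolution ε M c) ht0 σ y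
      (r := t⁻¹ * R) (by positivity)
    rw [mul_inv_cancel_left₀ ht0.ne', h1] at h2
    rw [← h2, setAverage_eq, setAverage_eq, integral_const_mul, smul_eq_mul, smul_eq_mul]
    ring
  · intro δ hδ
    have hcc : Tendsto (fun y => t • σ y) (cocompact (EuclideanSpace ℝ (Fin (k + 3))))
        (cocompact _) :=
      (σ.toHomeomorph.trans (Homeomorph.smulOfNeZero t ht0.ne')).isClosedEmbedding.tendsto_cocompact
    have hlim := (h.tendsto_toReal_pot.comp hcc).const_mul (t⁻¹ ^ 4)
    rw [mul_zero] at hlim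
    filter_upwards [hlim.eventually (gt_mem_nhds hδ)] with y hy
    refine lt_of_le_of_lt ?_ hy
    have h1 : t⁻¹ ^ 4 * t ^ 4 = 1 := by
      rw [← mul_pow, inv_mul_cancel₀ ht0.ne', one_pow]
    have h2 : 0 ≤ (pot (k + 1) M y).toReal := ENNReal.toReal_nonneg
    have h3 := mul_nonneg (sub_nonneg.2 htinv) h.const_nonneg
    have h4 : t⁻¹ ^ 4 * (t ^ 4 * extQuartic ε y) = extQuartic ε y := by
      rw [← mul_assoc, h1, one_mul]
    simp only [quarticSolution, extQuartic_smul, hq, Function.comp]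
    linarith

lemma zero_mem_contactSet (h : IsThinEquilibrium ε M S c) (hε0 : 0 < ε) (hε : ε ≤ 1)
    {x : EuclideanSpace ℝ (Fin (k + 3))}
    (hx : x ∈ contactSet (k + 2) (fun _ => 0) (quarticSolution ε M c)) :
    (0 : EuclideanSpace ℝ (Fin (k + 3))) ∈
      contactSet (k + 2) (fun _ => 0) (quarticSolution ε M c) := by
  have h1 : Tendsto (fun t : ℝ => t • x) (nhdsWithin 0 (Ioi 0)) (nhds 0) := by
    have : Continuous fun t : ℝ => t • x := by fun_prop
    simpa using (this.tendsto 0).mono_left nhdsWithin_le_nhds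
  refine (h.isCompact_contactSet hε0 hε).isClosed.mem_of_tendsto h1 ?_
  filter_upwards [Ioc_mem_nhdsGT (zero_lt_one' ℝ)] with t ht
  exact h.smul_map_mem_contactSet hε0.le (LinearIsometryEquiv.refl ℝ _) (fun _ => rfl)
    (fun _ => rfl) ht.1 ht.2 hx

lemma smul_mem_contactSet (h : IsThinEquilibrium ε M S c) (hε0 : 0 < ε) (hε : ε ≤ 1)
    {x : EuclideanSpace ℝ (Fin (k + 3))}
    (hx : x ∈ contactSet (k + 2) (fun _ => 0) (quarticSolution ε M c)) {t : ℝ}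
    (ht : t ∈ Icc (0 : ℝ) 1) :
    t • x ∈ contactSet (k + 2) (fun _ => 0) (quarticSolution ε M c) := by
  rcases ht.1.eq_or_lt with rfl | ht0
  · rw [zero_smul]
    exact h.zero_mem_contactSet hε0 hε hx
  · exact h.smul_map_mem_contactSet hε0.le (LinearIsometryEquiv.refl ℝ _) (fun _ => rfl)
      (fun _ => rfl) ht0 ht.2 hx

end IsThinEquilibrium

end QuarticSolutionContact

section Nonconvexity

variable {k : ℕ} {ε : ℝ} {M : Measure (EuclideanSpace ℝ (Fin (k + 3)))}
  {S : Set (EuclideanSpace ℝ (Fin (k + 3)))} {c : ℝ}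

lemma quarticWeight_mul_le_extQuartic (hε : 0 ≤ ε) {x : EuclideanSpace ℝ (Fin (k + 3))}
    (hx : x (Fin.last _) = 0) (i : Fin (k + 2)) :
    quarticWeight ε i * x i.castSucc ^ 4 ≤ extQuartic ε x := by
  have hw : ∀ i : Fin (k + 2), 0 ≤ quarticWeight ε i := fun i => by
    unfold quarticWeight
    split_ifs <;> positivity
  have h1 := Finset.single_le_sum (f := fun i : Fin (k + 2) => quarticWeight ε i * x i.castSucc ^ 4)
    (fun i _ => mul_nonneg (hw i) (by positivity)) (Finset.mem_univ i)
  have h2 : 0 ≤ x (Fin.castSucc 0) ^ 2 * x (Fin.castSucc 1) ^ 2 := by positivity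
  rw [extQuartic_thin ε hx, thinQuartic]
  simp only [thinProj_apply]
  linarith

lemma sq_mul_sq_le_extQuartic (hε : 0 ≤ ε) {x : EuclideanSpace ℝ (Fin (k + 3))}
    (hx : x (Fin.last _) = 0) :
    x (Fin.castSucc 0) ^ 2 * x (Fin.castSucc 1) ^ 2 ≤ extQuartic ε x := by
  have h1 : 0 ≤ ∑ i : Fin (k + 2), quarticWeight ε i * x i.castSucc ^ 4 :=
    Finset.sum_nonneg fun i _ => by
      have : 0 ≤ quarticWeight ε i := by
        unfold quarticWeight
        split_ifs <;> positivity
      positivity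
  rw [extQuartic_thin ε hx, thinQuartic]
  simp only [thinProj_apply]
  linarith

lemma extQuartic_single (ε s : ℝ) :
    extQuartic ε (EuclideanSpace.single (Fin.castSucc 0 : Fin (k + 3)) s) = ε * s ^ 4 := by
  rw [extQuartic_thin ε (by simp), thinQuartic]
  simp only [thinProj_apply]
  rw [Finset.sum_eq_single 0]
  · simp [quarticWeight]
  · intro i _ hi
    simp [hi]
  · simp

namespace IsThinEquilibrium

lemma single_mem_contactSet (h : IsThinEquilibrium ε M S c) (hε : 0 ≤ ε)
    (hconv : Convex ℝ (contactSet (k + 2) (fun _ => 0) (quarticSolution ε M c)))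
    {x : EuclideanSpace ℝ (Fin (k + 3))}
    (hx : x ∈ contactSet (k + 2) (fun _ => 0) (quarticSolution ε M c)) (i : Fin (k + 2)) :
    EuclideanSpace.single i.castSucc (x i.castSucc) ∈
      contactSet (k + 2) (fun _ => 0) (quarticSolution ε M c) := by
  classical
  set σ : EuclideanSpace ℝ (Fin (k + 3)) ≃ₗᵢ[ℝ] EuclideanSpace ℝ (Fin (k + 3)) :=
    LinearIsometryEquiv.piLpCongrRight 2 fun j =>
      if j = i.castSucc ∨ j = Fin.last _ then LinearIsometryEquiv.refl ℝ ℝ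
      else LinearIsometryEquiv.neg ℝ with hσ
  have hσx : ∀ y j, σ y j = if j = i.castSucc ∨ j = Fin.last _ then y j else -y j := fun y j => by
    simp only [hσ, LinearIsometryEquiv.piLpCongrRight_apply]
    split_ifs <;> simp
  have h1 := h.smul_map_mem_contactSet hε σ (fun y => by simp [hσx])
    (fun y => extQuartic_congr_abs fun j => by
      rw [hσx]
      split_ifs <;> simp) one_pos le_rfl hx
  rw [one_smul] at h1
  have h2 := hconv hx h1 (by norm_num : (0 : ℝ) ≤ 1 / 2) (by norm_num : (0 : ℝ) ≤ 1 / 2)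
    (by norm_num)
  convert h2 using 1
  ext j
  rw [PiLp.add_apply, PiLp.smul_apply, PiLp.smul_apply, hσx, PiLp.single_apply]
  by_cases hj : j = i.castSucc
  · simp [hj]
    ring
  by_cases hj2 : j = Fin.last _
  · simp [hj2, hx.1, (Fin.castSucc_lt_last i).ne']
  · simp [hj, hj2]

lemma pow_four_le_of_convex (h : IsThinEquilibrium ε M S c) (hε : 0 ≤ ε)
    (hconv : Convex ℝ (contactSet (k + 2) (fun _ => 0) (quarticSolution ε M c)))
    {x : EuclideanSpace ℝ (Fin (k + 3))}
    (hx : x ∈ contactSet (k + 2) (fun _ => 0) (quarticSolution ε M c)) (i : Fin (k + 2)) :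
    x i.castSucc ^ 4 ≤ 16 * c := by
  have h1 := h.single_mem_contactSet hε hconv hx i
  set a := x i.castSucc with ha
  by_cases hi : i = 0 ∨ i = 1
  · set σ := LinearIsometryEquiv.piLpCongrLeft 2 ℝ ℝ
      (Equiv.swap (Fin.castSucc 0 : Fin (k + 3)) (Fin.castSucc 1)) with hσ
    have hσx : ∀ y j, σ y j = y (Equiv.swap (Fin.castSucc 0 : Fin (k + 3)) (Fin.castSucc 1) j) :=
      fun y j => by simp [hσ, LinearIsometryEquiv.piLpCongrLeft_apply, Equiv.piCongrLeft']
    have h2 := h.smul_map_mem_contactSet hε σ (fun y => by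
      rw [hσx, Equiv.swap_apply_of_ne_of_ne (Fin.castSucc_lt_last _).ne'
        (Fin.castSucc_lt_last _).ne']) (extQuartic_swap ε) one_pos le_rfl h1
    rw [one_smul] at h2
    have h3 := hconv h1 h2 (by norm_num : (0 : ℝ) ≤ 1 / 2) (by norm_num : (0 : ℝ) ≤ 1 / 2)
      (by norm_num)
    have h4 := (sq_mul_sq_le_extQuartic hε h3.1).trans (extQuartic_le_of_mem_contactSet h3)
    simp only [PiLp.add_apply, PiLp.smul_apply, hσx, Equiv.swap_apply_left,
      Equiv.swap_apply_right] at h4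
    rcases hi with rfl | rfl
    · simp at h4
      nlinarith
    · simp at h4
      nlinarith
  · have h2 := (quarticWeight_mul_le_extQuartic hε h1.1 i).trans
      (extQuartic_le_of_mem_contactSet h1)
    simp only [quarticWeight, hi, if_false, one_mul, PiLp.single_apply, if_true] at h2
    linarith [h.const_nonneg]

lemma norm_pow_four_le_of_convex (h : IsThinEquilibrium ε M S c) (hε : 0 ≤ ε)
    (hconv : Convex ℝ (contactSet (k + 2) (fun _ => 0) (quarticSolution ε M c)))
    {x : EuclideanSpace ℝ (Fin (k + 3))}
    (hx : x ∈ contactSet (k + 2) (fun _ => 0) (quarticSolution ε M c)) :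
    ‖x‖ ^ 4 ≤ 16 * ((k : ℝ) + 2) ^ 2 * c := by
  have h1 := norm_pow_four_le_sum (thinProj (k + 2) x)
  have h2 : ∑ i, thinProj (k + 2) x i ^ 4 ≤ ∑ _i : Fin (k + 2), 16 * c :=
    Finset.sum_le_sum fun i _ => by
      rw [thinProj_apply]
      exact h.pow_four_le_of_convex hε hconv hx i
  rw [norm_thinProj hx.1] at h1
  simp only [Finset.sum_const, Finset.card_univ, Fintype.card_fin, nsmul_eq_mul] at h2
  push_cast at h1 h2
  nlinarith [mul_le_mul_of_nonneg_left h2 (by positivity : (0 : ℝ) ≤ k + 2)]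

lemma nonempty (h : IsThinEquilibrium ε M S c) : S.Nonempty := by
  have := h.isProbabilityMeasure
  exact h.ae_mem.exists

lemma inv_pow_le_const (h : IsThinEquilibrium ε M S c) (hε : 0 ≤ ε) {ρ : ℝ} (hρ : 0 < ρ)
    (hS : ∀ y ∈ S, ‖y‖ ≤ ρ) : (2 * ρ)⁻¹ ^ (k + 1) ≤ c := by
  have := h.isProbabilityMeasure
  obtain ⟨x, hx⟩ := h.nonempty
  have h1 := le_pot_of_norm_le (m := k + 1) (Nat.succ_ne_zero k) hρ (h.ae_mem.mono hS) (hS x hx)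
  rw [ENNReal.ofReal_le_iff_le_toReal (h.pot_ne_top x)] at h1
  have h2 := h.eq_zero hε hx
  have h3 := zero_le_extQuartic_thin hε (h.last_eq_zero x hx)
  unfold quarticSolution at h2
  linarith

lemma const_pos (h : IsThinEquilibrium ε M S c) (hε : 0 ≤ ε) : 0 < c := by
  obtain ⟨R, hR⟩ := h.isCompact.isBounded.exists_norm_le
  have hpos : 0 < max R 1 := by positivity
  exact lt_of_lt_of_le (by positivity)
    (h.inv_pow_le_const hε hpos fun y hy => (hR y hy).trans (le_max_left _ _))

lemma not_convex_contactSet (h : IsThinEquilibrium ε M S c)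
    (hε : ε = 1 / (10 ^ 5 * ((k : ℝ) + 2) ^ 2)) :
    ¬Convex ℝ (contactSet (k + 2) (fun _ => 0) (quarticSolution ε M c)) := by
  intro hconv
  have := h.isProbabilityMeasure
  have hε0 : 0 ≤ ε := by
    rw [hε]
    positivity
  have hc := h.const_pos hε0
  set ρ : ℝ := √(√(16 * ((k : ℝ) + 2) ^ 2 * c)) with hρ
  have hρ0 : 0 < ρ := by positivity
  have hρ4 : ρ ^ 4 = 16 * ((k : ℝ) + 2) ^ 2 * c := by
    rw [show 4 = 2 * 2 by rfl, pow_mul, hρ, Real.sq_sqrt (by positivity),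
      Real.sq_sqrt (by positivity)]
  have hS : ∀ y ∈ S, ‖y‖ ≤ ρ := fun y hy => by
    have := h.norm_pow_four_le_of_convex hε0 hconv (h.mem_contactSet_of_mem hε0 hy)
    rw [← hρ4] at this
    exact le_of_pow_le_pow_left₀ (by norm_num) hρ0.le this
  have h1 := h.inv_pow_le_const hε0 hρ0 hS
  set x : EuclideanSpace ℝ (Fin (k + 3)) := EuclideanSpace.single (Fin.castSucc 0) (5 * ρ) with hx
  have hxn : ‖x‖ = 5 * ρ := by
    rw [hx, PiLp.norm_single, Real.norm_of_nonneg (by positivity)]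
  have h2 := pot_le_of_norm_lt (m := k + 1) (h.ae_mem.mono hS) (x := x) (by linarith)
  have h3 := ENNReal.toReal_le_of_le_ofReal (pow_nonneg (inv_nonneg.2 (by linarith)) _) h2
  have h4 : (‖x‖ - ρ)⁻¹ ^ (k + 1) = (1 / 2) ^ (k + 1) * (2 * ρ)⁻¹ ^ (k + 1) := by
    rw [hxn, ← mul_pow]
    congr 1
    field_simp
    norm_num
  have h5 : ((1 : ℝ) / 2) ^ (k + 1) ≤ 1 / 2 :=
    pow_le_of_le_one (by norm_num) (by norm_num) (Nat.succ_ne_zero k)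
  have h6 : ((1 : ℝ) / 2) ^ (k + 1) * (2 * ρ)⁻¹ ^ (k + 1) ≤ 1 / 2 * c :=
    mul_le_mul h5 h1 (by positivity) (by norm_num)
  have h7 : extQuartic ε x = c / 10 := by
    rw [hx, extQuartic_single, mul_pow, hρ4, hε]
    field_simp
    norm_num
  have h8 := h.nonneg hε0 (x := x) (by simp [hx])
  unfold quarticSolution at h8
  linarith

end IsThinEquilibrium

end Nonconvexity

/-- a global solution of growth order 4 whose contact set is compact,
nonconvex and star-shaped with respect to the origin. -/
theorem statement5 (n : ℕ) (hn : 2 ≤ n) :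
    ∃ u : EuclideanSpace ℝ (Fin (n + 1)) → ℝ,
      IsGlobalSolution n (fun _ => 0) u ∧
      PolyGrowthOrder (n + 1) u 4 ∧
      IsCompact (contactSet n (fun _ => 0) u) ∧
      ¬Convex ℝ (contactSet n (fun _ => 0) u) ∧
      ∀ x ∈ contactSet n (fun _ => 0) u, ∀ t ∈ Set.Icc (0 : ℝ) 1,
        t • x ∈ contactSet n (fun _ => 0) u := by
  obtain ⟨k, rfl⟩ := Nat.exists_eq_add_of_le' hn
  set ε : ℝ := 1 / (10 ^ 5 * ((k : ℝ) + 2) ^ 2) with hε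
  have hε0 : 0 < ε := by positivity
  have hε1 : ε ≤ 1 := by
    rw [hε, div_le_one (by positivity)]
    have : (0 : ℝ) ≤ k := k.cast_nonneg
    nlinarith
  obtain ⟨M, S, c, h⟩ := exists_isThinEquilibrium (k := k) hε0 hε1
  exact ⟨quarticSolution ε M c, h.isGlobalSolution hε0.le, h.polyGrowthOrder hε0 hε1,
    h.isCompact_contactSet hε0 hε1, h.not_convex_contactSet hε,
    fun x hx t ht => h.smul_mem_contactSet hε0 hε1 hx ht⟩

end
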